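/- Let p be an odd prime, let m ≥ 0 and let 2m−1 ≤ r ≤ p−3. Then there is a G-equivariant 𝔽_{p²}-linear isomorphism ((V_{r+2+(m+1)(p−1)} / D^{m+1}(V_{r+2})) ⊗ V_{p−1}) ⊗_{𝔽_p} 𝔽_{p²} ≅ ind_T^G (V_m ⊗ ω₂^{r+2−m}), where V_m ⊗ ω₂^{r+2−m} denotes the representation of T on V_m ⊗_{𝔽_p} 𝔽_{p²} in which t ∈ T acts by ω₂(t)^{r+2−m} times the restriction to T of the G-action on V_m, and where ind_T^G of a T-representation (σ, W) is the space of functions h : G → W with h(tg) = σ(t)(h(g)), with G acting by right translation. -/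

import Mathlib

open MvPolynomial

noncomputable section

/-- `P ∈ 𝔽_{p²}[X,Y,S,T]` (with `X = X(0,0)`, `Y = X(0,1)`, `S = X(1,0)`, `T = X(1,1)`)
is bihomogeneous of bidegree `(n₁, n₂)`; this models `V_{n₁} ⊗ V_{n₂}` after scalar
extension. -/
def IsBiHom {K : Type*} [CommRing K] (n₁ n₂ : ℕ)
    (P : MvPolynomial (Fin 2 × Fin 2) K) : Prop :=
  ∀ dd ∈ P.support, dd (0, 0) + dd (0, 1) = n₁ ∧ dd (1, 0) + dd (1, 1) = n₂

/-- Serre's operator `D = X^p ∂/∂X + Y^p ∂/∂Y`, acting on the `(X,Y)`-variables. -/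
def DK (p : ℕ) (K : Type*) [CommRing K] :
    Module.End K (MvPolynomial (Fin 2 × Fin 2) K) :=
  (LinearMap.mulLeft K ((X (0, 0) : MvPolynomial (Fin 2 × Fin 2) K) ^ p)) ∘ₗ
      (pderiv ((0, 0) : Fin 2 × Fin 2)).toLinearMap +
    (LinearMap.mulLeft K ((X (0, 1) : MvPolynomial (Fin 2 × Fin 2) K) ^ p)) ∘ₗ
      (pderiv ((0, 1) : Fin 2 × Fin 2)).toLinearMap

/-- The action of `g = [[a,b],[c,d]] ∈ GL₂(𝔽_p)` on `𝔽_{p²}[X,Y,S,T]`, acting by the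
standard substitution simultaneously on `(X,Y)` and on `(S,T)`. -/
def actK (p : ℕ) (K : Type*) [CommRing K] [Algebra (ZMod p) K]
    (g : Matrix (Fin 2) (Fin 2) (ZMod p)) :
    MvPolynomial (Fin 2 × Fin 2) K →ₗ[K] MvPolynomial (Fin 2 × Fin 2) K :=
  (aeval fun v : Fin 2 × Fin 2 =>
    C (algebraMap (ZMod p) K (g 0 v.2)) * X (v.1, 0) +
      C (algebraMap (ZMod p) K (g 1 v.2)) * X (v.1, 1)).toLinearMap

/-- The action of `g ∈ GL₂(𝔽_p)` on `V_m ⊗ 𝔽_{p²}`, modeled on `𝔽_{p²}[S,T]`. -/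
def actK2 (p : ℕ) (K : Type*) [CommRing K] [Algebra (ZMod p) K]
    (g : Matrix (Fin 2) (Fin 2) (ZMod p)) :
    MvPolynomial (Fin 2) K →ₗ[K] MvPolynomial (Fin 2) K :=
  (aeval fun i : Fin 2 =>
    C (algebraMap (ZMod p) K (g 0 i)) * X 0 +
      C (algebraMap (ZMod p) K (g 1 i)) * X 1).toLinearMap

end

section SubstitutionAction

variable {p : ℕ} {K : Type*} [Field K] [Algebra (ZMod p) K]

/-- `actK` as an algebra homomorphism. -/
noncomputable def substHom (p : ℕ) (K : Type*) [CommRing K] [Algebra (ZMod p) K]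
    (g : Matrix (Fin 2) (Fin 2) (ZMod p)) :
    MvPolynomial (Fin 2 × Fin 2) K →ₐ[K] MvPolynomial (Fin 2 × Fin 2) K :=
  aeval fun v : Fin 2 × Fin 2 =>
    C (algebraMap (ZMod p) K (g 0 v.2)) * X (v.1, 0) +
      C (algebraMap (ZMod p) K (g 1 v.2)) * X (v.1, 1)

theorem actK_apply (g : Matrix (Fin 2) (Fin 2) (ZMod p)) (R : MvPolynomial (Fin 2 × Fin 2) K) :
    actK p K g R = substHom p K g R := rfl

theorem substHom_X (g : Matrix (Fin 2) (Fin 2) (ZMod p)) (v : Fin 2 × Fin 2) :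
    substHom p K g (X v) = C (algebraMap (ZMod p) K (g 0 v.2)) * X (v.1, 0) +
      C (algebraMap (ZMod p) K (g 1 v.2)) * X (v.1, 1) := by
  simp [substHom]

theorem substHom_mul (g h : Matrix (Fin 2) (Fin 2) (ZMod p)) :
    substHom p K (g * h) = (substHom p K g).comp (substHom p K h) := by
  apply MvPolynomial.algHom_ext
  intro v
  simp only [AlgHom.comp_apply, substHom_X, map_add, map_mul, Matrix.mul_apply, Fin.sum_univ_two,
    algHom_C, algebraMap_eq]
  ring

theorem actK_mul_apply (g h : Matrix (Fin 2) (Fin 2) (ZMod p))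
    (R : MvPolynomial (Fin 2 × Fin 2) K) :
    actK p K (g * h) R = actK p K g (actK p K h R) := by
  simp [actK_apply, substHom_mul]

theorem actK_map_mul (g : Matrix (Fin 2) (Fin 2) (ZMod p))
    (R S : MvPolynomial (Fin 2 × Fin 2) K) :
    actK p K g (R * S) = actK p K g R * actK p K g S := by
  simp [actK_apply]

theorem actK_map_pow (g : Matrix (Fin 2) (Fin 2) (ZMod p))
    (R : MvPolynomial (Fin 2 × Fin 2) K) (k : ℕ) :
    actK p K g (R ^ k) = actK p K g R ^ k := by
  simp [actK_apply]

end SubstitutionAction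

section SerreOperator

variable {p : ℕ} {K : Type*}

theorem DK_apply [CommRing K] (R : MvPolynomial (Fin 2 × Fin 2) K) :
    DK p K R = X (0, 0) ^ p * pderiv (0, 0) R + X (0, 1) ^ p * pderiv (0, 1) R := by
  simp [DK]

theorem DK_mul [CommRing K] (R S : MvPolynomial (Fin 2 × Fin 2) K) :
    DK p K (R * S) = R * DK p K S + DK p K R * S := by
  simp only [DK_apply, Derivation.leibniz, smul_eq_mul]
  ring

theorem DK_C [CommRing K] (c : K) : DK p K (C c) = 0 := by
  simp [DK_apply]

theorem DK_X_zero [CommRing K] (j : Fin 2) :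
    DK p K (X (0, j)) = X (0, j) ^ p := by
  fin_cases j <;> simp [DK_apply, pderiv_X]

theorem DK_X_one [CommRing K] (j : Fin 2) : DK p K (X (1, j)) = 0 := by
  fin_cases j <;> simp [DK_apply, pderiv_X]

theorem DK_pow [CommRing K] (R : MvPolynomial (Fin 2 × Fin 2) K) (k : ℕ) :
    DK p K (R ^ k) = (k : MvPolynomial (Fin 2 × Fin 2) K) * R ^ (k - 1) * DK p K R := by
  simp only [DK_apply, Derivation.leibniz_pow, smul_eq_mul, nsmul_eq_mul]
  ring

theorem DK_pow_char [CommRing K] [CharP K p] (R : MvPolynomial (Fin 2 × Fin 2) K) :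
    DK p K (R ^ p) = 0 := by
  rw [DK_pow, CharP.cast_eq_zero]
  simp

theorem DK_pow_mul_of_eq_zero [CommRing K] {c : MvPolynomial (Fin 2 × Fin 2) K}
    (hc : DK p K c = 0) (j : ℕ) (R : MvPolynomial (Fin 2 × Fin 2) K) :
    (DK p K ^ j) (c * R) = c * (DK p K ^ j) R := by
  induction j with
  | zero => simp
  | succ j ih => rw [pow_succ', Module.End.mul_apply, ih, DK_mul, hc, Module.End.mul_apply]; simp

theorem DK_pow_const [CommRing K] {c : MvPolynomial (Fin 2 × Fin 2) K}
    (hc : DK p K c = 0) (k : ℕ) : DK p K (c ^ k) = 0 := by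
  rw [DK_pow, hc, mul_zero]

theorem DK_mul_const [CommRing K] {c d : MvPolynomial (Fin 2 × Fin 2) K}
    (hc : DK p K c = 0) (hd : DK p K d = 0) : DK p K (c * d) = 0 := by
  rw [DK_mul, hc, hd]; simp

theorem DK_actK [Fact p.Prime] [Field K] [Algebra (ZMod p) K]
    (g : Matrix (Fin 2) (Fin 2) (ZMod p)) (R : MvPolynomial (Fin 2 × Fin 2) K) :
    DK p K (actK p K g R) = actK p K g (DK p K R) := by
  have : CharP K p := charP_of_injective_algebraMap (algebraMap (ZMod p) K).injective p
  induction R using MvPolynomial.induction_on with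
  | C a => simp [actK_apply, DK_C]
  | add R S hR hS => simp only [map_add, hR, hS]
  | mul_X R v hR =>
    rw [actK_map_mul, DK_mul, DK_mul, hR, map_add, actK_map_mul, actK_map_mul]
    congr 2
    obtain ⟨i, j⟩ := v
    have hF (a : ZMod p) : algebraMap (ZMod p) K a ^ p = algebraMap (ZMod p) K a := by
      rw [← map_pow, ZMod.pow_card]
    have hi : i = 0 ∨ i = 1 := by fin_cases i <;> simp
    rcases hi with rfl | rfl
    · rw [DK_X_zero, actK_map_pow]
      simp only [actK_apply, substHom_X, map_add, DK_mul, DK_C, DK_X_zero]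
      rw [add_pow_char, mul_pow, mul_pow]
      simp only [← map_pow, hF]
      simp
    · rw [DK_X_one]
      simp [actK_apply, substHom_X, DK_mul, DK_C, DK_X_one]

theorem DK_pow_actK [Fact p.Prime] [Field K] [Algebra (ZMod p) K]
    (g : Matrix (Fin 2) (Fin 2) (ZMod p)) (j : ℕ) (R : MvPolynomial (Fin 2 × Fin 2) K) :
    (DK p K ^ j) (actK p K g R) = actK p K g ((DK p K ^ j) R) := by
  induction j with
  | zero => simp
  | succ j ih => rw [pow_succ', Module.End.mul_apply, ih, DK_actK, Module.End.mul_apply]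

end SerreOperator

section DicksonInvariant

variable {p : ℕ} {K : Type*}

/-- The Dickson invariant `X^p Y - X Y^p`. -/
noncomputable def dickson (p : ℕ) (K : Type*) [CommRing K] : MvPolynomial (Fin 2 × Fin 2) K :=
  X (0, 0) ^ p * X (0, 1) - X (0, 0) * X (0, 1) ^ p

theorem DK_dickson [CommRing K] [CharP K p] : DK p K (dickson p K) = 0 := by
  simp only [dickson, map_sub, DK_mul, DK_pow_char, DK_X_zero]
  ring

theorem actK_dickson [Fact p.Prime] [Field K] [Algebra (ZMod p) K]
    (g : Matrix (Fin 2) (Fin 2) (ZMod p)) :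
    actK p K g (dickson p K) = C (algebraMap (ZMod p) K g.det) * dickson p K := by
  have : CharP K p := charP_of_injective_algebraMap (algebraMap (ZMod p) K).injective p
  have hF (a : ZMod p) : algebraMap (ZMod p) K a ^ p = algebraMap (ZMod p) K a := by
    rw [← map_pow, ZMod.pow_card]
  simp only [dickson, map_sub, actK_map_mul, actK_map_pow]
  simp only [actK_apply, substHom_X]
  rw [add_pow_char, mul_pow, mul_pow, add_pow_char, mul_pow, mul_pow]
  simp only [← map_pow, hF, Matrix.det_fin_two, map_sub, map_mul]
  ring

end DicksonInvariant

section BihomogeneousSubmodule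

variable {p : ℕ} {K : Type*} [Field K]

/-- The exponents of bidegree `(k - 1, p - 1)`; there are none for `k = 0`. -/
def biExponents (p k : ℕ) : Set (Fin 2 × Fin 2 →₀ ℕ) :=
  {dd | dd (0, 0) + dd (0, 1) + 1 = k ∧ dd (1, 0) + dd (1, 1) + 1 = p}

/-- The bihomogeneous polynomials of bidegree `(k - 1, p - 1)`; the zero submodule for `k = 0`. -/
noncomputable def biHom (p : ℕ) (K : Type*) [Field K] (k : ℕ) :
    Submodule K (MvPolynomial (Fin 2 × Fin 2) K) :=
  restrictSupport K (biExponents p k)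

/-- The monomial `X^a Y^b S^c T^d`. -/
noncomputable def quadMonomial (K : Type*) [Field K] (a b c d : ℕ) :
    MvPolynomial (Fin 2 × Fin 2) K :=
  X (0, 0) ^ a * X (0, 1) ^ b * X (1, 0) ^ c * X (1, 1) ^ d

theorem monomial_eq_quadMonomial (dd : Fin 2 × Fin 2 →₀ ℕ) :
    monomial dd (1 : K) = quadMonomial K (dd (0, 0)) (dd (0, 1)) (dd (1, 0)) (dd (1, 1)) := by
  rw [monomial_eq, Finsupp.prod_fintype _ _ (by simp), Fintype.prod_prod_type]
  simp [Fin.prod_univ_two, quadMonomial, mul_assoc]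

theorem exists_monomial_eq_quadMonomial (a b c d : ℕ) :
    ∃ dd : Fin 2 × Fin 2 →₀ ℕ, dd (0, 0) = a ∧ dd (0, 1) = b ∧ dd (1, 0) = c ∧ dd (1, 1) = d ∧
      quadMonomial K a b c d = monomial dd (1 : K) := by
  refine ⟨Finsupp.equivFunOnFinite.symm fun v => (![![a, b], ![c, d]] v.1) v.2, ?_, ?_, ?_, ?_, ?_⟩
  all_goals simp [monomial_eq_quadMonomial]

theorem mem_biHom {k : ℕ} {R : MvPolynomial (Fin 2 × Fin 2) K} :
    R ∈ biHom p K k ↔ ∀ dd ∈ R.support, dd (0, 0) + dd (0, 1) + 1 = k ∧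
      dd (1, 0) + dd (1, 1) + 1 = p := by
  rw [biHom, mem_restrictSupport_iff]
  rfl

theorem isBiHom_iff (hp : 0 < p) {n : ℕ} {R : MvPolynomial (Fin 2 × Fin 2) K} :
    IsBiHom n (p - 1) R ↔ R ∈ biHom p K (n + 1) := by
  rw [mem_biHom]
  refine forall₂_congr fun dd _ => ?_
  omega

theorem quadMonomial_mem_biHom {k a b c d : ℕ} (hab : a + b + 1 = k) (hcd : c + d + 1 = p) :
    quadMonomial K a b c d ∈ biHom p K k := by
  classical
  obtain ⟨dd, h1, h2, h3, h4, h⟩ := exists_monomial_eq_quadMonomial (K := K) a b c d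
  rw [h, mem_biHom]
  intro ee hee
  rw [support_monomial, if_neg one_ne_zero, Finset.mem_singleton] at hee
  subst hee
  omega

theorem biHom_le {k : ℕ} {N : Submodule K (MvPolynomial (Fin 2 × Fin 2) K)}
    (h : ∀ a b c d, a + b + 1 = k → c + d + 1 = p → quadMonomial K a b c d ∈ N) :
    biHom p K k ≤ N := by
  rw [biHom, restrictSupport_eq_span, Submodule.span_le]
  rintro _ ⟨dd, hdd, rfl⟩
  simp only [monomial_eq_quadMonomial]
  exact h _ _ _ _ hdd.1 hdd.2

theorem biHom_zero : biHom p K 0 = ⊥ :=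
  le_bot_iff.mp <| biHom_le fun a b c d h => by omega

/-- The exponents of bidegree `(k - 1, p - 1)` are parametrized by the exponents of `X` and `S`. -/
noncomputable def biExponentsEquiv (p k : ℕ) : biExponents p k ≃ Fin k × Fin p where
  toFun dd := (⟨dd.1 (0, 0), by have := dd.2.1; omega⟩, ⟨dd.1 (1, 0), by have := dd.2.2; omega⟩)
  invFun x := ⟨Finsupp.equivFunOnFinite.symm fun v =>
    (![![x.1.1, k - 1 - x.1.1], ![x.2.1, p - 1 - x.2.1]] v.1) v.2, by
      have := x.1.2
      have := x.2.2
      simp only [biExponents, Set.mem_ofPred_eq, Finsupp.equivFunOnFinite_symm_apply_apply,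
        Matrix.cons_val_zero, Matrix.cons_val_one]
      omega⟩
  left_inv := by
    rintro ⟨dd, h1, h2⟩
    ext ⟨i, j⟩
    fin_cases i <;> fin_cases j <;> simp <;> omega
  right_inv := by
    rintro ⟨x, y⟩
    simp

instance finite_biExponents (p k : ℕ) : Finite (biExponents p k) :=
  Finite.of_equiv _ (biExponentsEquiv p k).symm

instance finiteDimensional_biHom (p k : ℕ) : FiniteDimensional K (biHom p K k) :=
  Module.Basis.finiteDimensional_of_finite (basisRestrictSupport K (biExponents p k))

theorem finrank_biHom (p k : ℕ) : Module.finrank K (biHom p K k) = k * p := by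
  rw [biHom, Module.finrank_eq_nat_card_basis (basisRestrictSupport K (biExponents p k)),
    Nat.card_congr (biExponentsEquiv p k)]
  simp

theorem isBiHom_mul {a b c d : ℕ} {R S : MvPolynomial (Fin 2 × Fin 2) K} (hR : IsBiHom a b R)
    (hS : IsBiHom c d S) : IsBiHom (a + c) (b + d) (R * S) := by
  classical
  intro dd hdd
  obtain ⟨e, he, f, hf, rfl⟩ := Finset.mem_add.mp (support_mul R S hdd)
  have h1 := hR e he
  have h2 := hS f hf
  simp only [Finsupp.add_apply]
  omega

theorem isBiHom_add {a b : ℕ} {R S : MvPolynomial (Fin 2 × Fin 2) K} (hR : IsBiHom a b R)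
    (hS : IsBiHom a b S) : IsBiHom a b (R + S) := by
  classical
  intro dd hdd
  rcases Finset.mem_union.mp (support_add hdd) with h | h
  exacts [hR dd h, hS dd h]

theorem isBiHom_C (c : K) : IsBiHom 0 0 (C c) := by
  classical
  intro dd hdd
  rw [C_apply] at hdd
  have := support_monomial_subset hdd
  simp at this
  simp [this]

theorem isBiHom_pow {a b : ℕ} {R : MvPolynomial (Fin 2 × Fin 2) K} (hR : IsBiHom a b R) (k : ℕ) :
    IsBiHom (k * a) (k * b) (R ^ k) := by
  induction k with
  | zero => simpa using isBiHom_C (1 : K)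
  | succ k ih => rw [pow_succ, add_mul, add_mul, one_mul, one_mul]; exact isBiHom_mul ih hR

theorem isBiHom_X_zero (j : Fin 2) :
    IsBiHom 1 0 (X (0, j) : MvPolynomial (Fin 2 × Fin 2) K) := by
  intro dd hdd
  rw [support_X, Finset.mem_singleton] at hdd
  subst hdd
  fin_cases j <;> simp

theorem isBiHom_X_one (j : Fin 2) :
    IsBiHom 0 1 (X (1, j) : MvPolynomial (Fin 2 × Fin 2) K) := by
  intro dd hdd
  rw [support_X, Finset.mem_singleton] at hdd
  subst hdd
  fin_cases j <;> simp

theorem isBiHom_dickson (p : ℕ) : IsBiHom (p + 1) 0 (dickson p K) := by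
  have h1 := isBiHom_mul (isBiHom_pow (isBiHom_X_zero (K := K) 0) p) (isBiHom_X_zero 1)
  have h2 := isBiHom_mul (isBiHom_C (-1)) (isBiHom_mul
    (isBiHom_pow (isBiHom_X_zero (K := K) 1) p) (isBiHom_X_zero 0))
  simp only [mul_one, mul_zero, add_zero, zero_add] at h1 h2
  convert isBiHom_add h1 h2 using 1
  simp only [dickson, map_neg, map_one]
  ring

theorem mul_mem_biHom {n k : ℕ} {R S : MvPolynomial (Fin 2 × Fin 2) K} (hR : IsBiHom n 0 R)
    (hS : S ∈ biHom p K k) : R * S ∈ biHom p K (k + n) := by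
  classical
  rw [mem_biHom] at hS ⊢
  intro dd hdd
  obtain ⟨e, he, f, hf, rfl⟩ := Finset.mem_add.mp (support_mul R S hdd)
  have h1 := hR e he
  have h2 := hS f hf
  simp only [Finsupp.add_apply]
  omega

theorem actK_mem_biHom [Algebra (ZMod p) K] (hp : 0 < p) {k : ℕ}
    (g : Matrix (Fin 2) (Fin 2) (ZMod p)) {R : MvPolynomial (Fin 2 × Fin 2) K}
    (hR : R ∈ biHom p K k) : actK p K g R ∈ biHom p K k := by
  suffices h : biHom p K k ≤ (biHom p K k).comap (actK p K g) from h hR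
  refine biHom_le fun a b c d hab hcd => ?_
  have h0 (j : Fin 2) : IsBiHom 1 0 (substHom p K g (X (0, j))) := by
    rw [substHom_X]
    exact isBiHom_add (by simpa using isBiHom_mul (isBiHom_C _) (isBiHom_X_zero (K := K) 0))
      (by simpa using isBiHom_mul (isBiHom_C _) (isBiHom_X_zero (K := K) 1))
  have h1 (j : Fin 2) : IsBiHom 0 1 (substHom p K g (X (1, j))) := by
    rw [substHom_X]
    exact isBiHom_add (by simpa using isBiHom_mul (isBiHom_C _) (isBiHom_X_one (K := K) 0))
      (by simpa using isBiHom_mul (isBiHom_C _) (isBiHom_X_one (K := K) 1))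
  have h := isBiHom_mul (isBiHom_mul (isBiHom_mul (isBiHom_pow (h0 0) a) (isBiHom_pow (h0 1) b))
    (isBiHom_pow (h1 0) c)) (isBiHom_pow (h1 1) d)
  rw [Submodule.mem_comap, actK_apply, quadMonomial, ← hab, ← isBiHom_iff hp]
  simp only [map_mul, map_pow]
  convert h using 1 <;> omega

theorem DK_quadMonomial (a b c d : ℕ) : DK p K (quadMonomial K a b c d) =
    (a : K) • quadMonomial K (a - 1 + p) b c d + (b : K) • quadMonomial K a (b - 1 + p) c d := by
  simp only [quadMonomial, DK_mul, DK_pow, DK_X_zero, DK_X_one, smul_eq_C_mul, map_natCast,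
    pow_add]
  ring

theorem DK_mem_biHom {k : ℕ} {R : MvPolynomial (Fin 2 × Fin 2) K}
    (hR : R ∈ biHom p K k) : DK p K R ∈ biHom p K (k + p - 1) := by
  suffices h : biHom p K k ≤ (biHom p K (k + p - 1)).comap (DK p K) from h hR
  refine biHom_le fun a b c d hab hcd => ?_
  rw [Submodule.mem_comap, DK_quadMonomial]
  refine add_mem ?_ ?_
  · rcases Nat.eq_zero_or_pos a with rfl | ha
    · simp
    · exact Submodule.smul_mem _ _ (quadMonomial_mem_biHom (by omega) hcd)
  · rcases Nat.eq_zero_or_pos b with rfl | hb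
    · simp
    · exact Submodule.smul_mem _ _ (quadMonomial_mem_biHom (by omega) hcd)

end BihomogeneousSubmodule

section Dehomogenization

variable {p : ℕ} {K : Type*} [Field K]

/-- The substitution `Y = T = 1`, with `X` as the main variable and `S` in the coefficients. -/
noncomputable def dehom (K : Type*) [Field K] :
    MvPolynomial (Fin 2 × Fin 2) K →ₐ[K] Polynomial (Polynomial K) :=
  aeval fun v => (![![Polynomial.X, 1], ![Polynomial.C Polynomial.X, 1]] v.1) v.2

theorem dehom_quadMonomial (a b c d : ℕ) :
    dehom K (quadMonomial K a b c d) =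
      Polynomial.monomial a (Polynomial.monomial c 1) := by
  simp only [dehom, quadMonomial, map_mul, map_pow, aeval_X, Matrix.cons_val_zero,
    Matrix.cons_val_one, one_pow, mul_one, ← Polynomial.C_pow, Polynomial.X_pow_eq_monomial,
    Polynomial.monomial_mul_C, one_mul]

theorem coeff_dehom {k : ℕ} {R : MvPolynomial (Fin 2 × Fin 2) K} (hR : R ∈ biHom p K k)
    {dd : Fin 2 × Fin 2 →₀ ℕ} (hdd : dd ∈ biExponents p k) :
    ((dehom K R).coeff (dd (0, 0))).coeff (dd (1, 0)) = R.coeff dd := by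
  suffices h : biHom p K k ≤ LinearMap.eqLocus
      (Polynomial.lcoeff K (dd (1, 0)) ∘ₗ
        (Polynomial.lcoeff (Polynomial K) (dd (0, 0))).restrictScalars K ∘ₗ
        (dehom K).toLinearMap) (lcoeff K dd) from h hR
  classical
  refine biHom_le fun a b c d hab hcd => ?_
  obtain ⟨ee, rfl, rfl, rfl, rfl, h⟩ := exists_monomial_eq_quadMonomial (K := K) a b c d
  obtain ⟨h1, h2⟩ := hdd
  simp only [LinearMap.mem_eqLocus, LinearMap.comp_apply, LinearMap.restrictScalars_apply,
    AlgHom.toLinearMap_apply, dehom_quadMonomial, Polynomial.lcoeff_apply, lcoeff_apply]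
  rw [h, coeff_monomial, Polynomial.coeff_monomial]
  by_cases h00 : ee (0, 0) = dd (0, 0)
  · rw [if_pos h00, Polynomial.coeff_monomial]
    refine if_congr ⟨fun h10 => ?_, fun h => by rw [h]⟩ rfl rfl
    ext ⟨i, j⟩
    fin_cases i <;> fin_cases j <;> simp <;> omega
  · rw [if_neg h00, if_neg fun h => h00 (by rw [h]), Polynomial.coeff_zero]

theorem eq_zero_of_dehom_eq_zero {k : ℕ} {R : MvPolynomial (Fin 2 × Fin 2) K}
    (hR : R ∈ biHom p K k) (h : dehom K R = 0) : R = 0 := by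
  ext dd
  by_cases hdd : dd ∈ biExponents p k
  · rw [← coeff_dehom hR hdd, h]
    simp
  · rw [coeff_zero, ← notMem_support_iff]
    exact fun h => hdd (mem_biHom.mp hR dd h)

theorem degree_dehom_lt {k : ℕ} {R : MvPolynomial (Fin 2 × Fin 2) K} (hR : R ∈ biHom p K k) :
    (dehom K R).degree < k := by
  suffices h : biHom p K k ≤ ((Polynomial.degreeLT (Polynomial K) k).restrictScalars K).comap
      (dehom K).toLinearMap from Polynomial.mem_degreeLT.mp (h hR)
  refine biHom_le fun a b c d hab hcd => ?_
  simp only [Submodule.mem_comap, AlgHom.toLinearMap_apply, dehom_quadMonomial,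
    Submodule.restrictScalars_mem, Polynomial.mem_degreeLT]
  refine (Polynomial.degree_monomial_le _ _).trans_lt ?_
  exact_mod_cast (by omega : a < k)

theorem dehom_dickson : dehom K (dickson p K) = Polynomial.X ^ p - Polynomial.X := by
  simp [dehom, dickson]

theorem dehom_DK {s : ℕ} {R : MvPolynomial (Fin 2 × Fin 2) K} (hR : R ∈ biHom p K (s + 1)) :
    dehom K (DK p K R) = (Polynomial.X ^ p - Polynomial.X) * (dehom K R).derivative +
      (s : K) • dehom K R := by
  suffices h : biHom p K (s + 1) ≤ LinearMap.eqLocus ((dehom K).toLinearMap ∘ₗ DK p K)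
      (LinearMap.mulLeft K (Polynomial.X ^ p - Polynomial.X) ∘ₗ
        (Polynomial.derivative (R := Polynomial K)).restrictScalars K ∘ₗ (dehom K).toLinearMap +
        (s : K) • (dehom K).toLinearMap) from h hR
  refine biHom_le fun a b c d hab hcd => ?_
  obtain rfl : s = a + b := by omega
  simp only [LinearMap.mem_eqLocus, LinearMap.comp_apply, LinearMap.add_apply,
    LinearMap.smul_apply, LinearMap.restrictScalars_apply, LinearMap.mulLeft_apply,
    AlgHom.toLinearMap_apply]
  rw [DK_quadMonomial, map_add, map_smul, map_smul, dehom_quadMonomial, dehom_quadMonomial,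
    dehom_quadMonomial, Polynomial.derivative_monomial, sub_mul]
  rcases a with _ | a
  · simp
  · have h (n : ℕ) : Polynomial.monomial c (1 : K) * (n : Polynomial K) =
        (n : K) • Polynomial.monomial c (1 : K) := by
      rw [Algebra.smul_def, map_natCast, mul_comm]
    simp only [Polynomial.X_pow_mul_monomial, Polynomial.X_mul_monomial, Nat.add_sub_cancel, h,
      ← Polynomial.smul_monomial, mul_smul_comm]
    push_cast
    module

theorem eq_zero_of_X_pow_sub_X_mul_derivative [CharP K p] (N : ℕ) :
    ∀ (s : K) (f h : Polynomial (Polynomial K)), (∀ i < N, s - (i : K) ≠ 0) →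
      (Polynomial.X ^ p - Polynomial.X) * f.derivative + s • f =
        (Polynomial.X ^ p - Polynomial.X) ^ N * h → f.degree < (p * N : ℕ) → 1 < p → f = 0 := by
  induction N with
  | zero => 
    intro s f h _ _ hd _
    simpa using hd
  | succ N ih =>
    intro s f h hs hf hd hp
    set w : Polynomial (Polynomial K) := Polynomial.X ^ p - Polynomial.X with hw
    have hw' : w.derivative = -1 := by
      simp [hw, Polynomial.derivative_X_pow]
    have hs0 : s ≠ 0 := by simpa using hs 0 (by omega)
    obtain ⟨f₁, rfl⟩ : ∃ f₁, f = w * f₁ := by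
      refine ⟨s⁻¹ • (w ^ N * h - f.derivative), ?_⟩
      rw [mul_smul_comm, mul_sub, ← mul_assoc, ← pow_succ', ← hf, add_sub_cancel_left,
        inv_smul_smul₀ hs0]
    have hwd : w.degree = p := by
      rw [hw, Polynomial.degree_sub_eq_left_of_degree_lt] <;> simp [hp]
    have hw0 : w ≠ 0 := by
      rintro h
      simp [h] at hwd
    suffices f₁ = 0 by rw [this, mul_zero]
    refine ih (s - 1) f₁ h (fun i hi => ?_) ?_ ?_ hp
    · have := hs (i + 1) (by omega)
      push_cast at this
      rwa [sub_sub, add_comm]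
    · apply mul_left_cancel₀ hw0
      rw [← mul_assoc w (w ^ N), ← pow_succ', ← hf, Polynomial.derivative_mul, hw', sub_smul,
        one_smul, mul_add, mul_add, mul_sub, mul_smul_comm]
      ring
    · by_cases h0 : f₁ = 0
      · rw [h0, Polynomial.degree_zero]
        exact WithBot.bot_lt_coe _
      rw [Polynomial.degree_mul, hwd, Polynomial.degree_eq_natDegree h0] at hd
      rw [Polynomial.degree_eq_natDegree h0]
      have hd' : p + f₁.natDegree < p * (N + 1) := by exact_mod_cast hd
      exact_mod_cast (by linarith : f₁.natDegree < p * N)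

/-- The image of `D` meets the multiples of `θ^{i+1}` trivially. -/
theorem eq_zero_of_DK_eq_dickson_pow_mul [CharP K p] [Fact p.Prime] {q i s : ℕ} (hq : 1 ≤ q)
    (hqi : q + i < p) (hs : s = q + i * (p + 1)) {S H : MvPolynomial (Fin 2 × Fin 2) K}
    (hS : S ∈ biHom p K (s + 1)) (h : DK p K S = dickson p K ^ (i + 1) * H) : S = 0 := by
  have hp := (Fact.out : p.Prime).one_lt
  refine eq_zero_of_dehom_eq_zero hS ?_
  have h' := congr_arg (dehom K) h
  rw [dehom_DK hS, map_mul, map_pow, dehom_dickson] at h'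
  refine eq_zero_of_X_pow_sub_X_mul_derivative (i + 1) _ _ _ (fun l hl h0 => ?_) h' ?_ hp
  · have hsl : ((s - l : ℕ) : K) = 0 := by
      rw [Nat.cast_sub (by nlinarith), h0]
    rw [CharP.cast_eq_zero_iff K p, hs] at hsl
    have : q + i * (p + 1) - l = (q + i - l) + p * i := by
      zify [(by omega : l ≤ q + i), (by nlinarith : l ≤ q + i * (p + 1))]
      ring
    rw [this, Nat.dvd_add_left (dvd_mul_right p i)] at hsl
    have := Nat.le_of_dvd (by omega) hsl
    omega
  · refine (degree_dehom_lt hS).trans_le ?_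
    have : s + 1 ≤ p * (i + 1) := by nlinarith
    exact_mod_cast this

theorem dickson_ne_zero [Fact p.Prime] : dickson p K ≠ 0 := by
  intro h
  have h' := congr_arg (dehom K) h
  rw [dehom_dickson, map_zero] at h'
  have := congr_arg (Polynomial.coeff · 1) h'
  simp [Polynomial.coeff_X_pow, (Fact.out : p.Prime).one_lt.ne] at this

end Dehomogenization

section NonsplitTorus

/-- The data of a quadratic extension `K = 𝔽_p(α)` of `𝔽_p` with `α² = β`, for `p` odd. -/
structure QuadraticGenerator (p : ℕ) [Fact p.Prime] {K : Type*} [Field K] [Algebra (ZMod p) K]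
    [Fintype K] (α : K) (β : ZMod p) : Prop where
  odd : Odd p
  card : Fintype.card K = p ^ 2
  sq : α ^ 2 = algebraMap (ZMod p) K β
  notMem : α ∉ Set.range (algebraMap (ZMod p) K)

variable {p : ℕ} [Fact p.Prime] {K : Type*} [Field K] [Algebra (ZMod p) K]
  {α : K} {β : ZMod p}

theorem algebraMap_pow_char (a : ZMod p) :
    algebraMap (ZMod p) K a ^ p = algebraMap (ZMod p) K a := by
  rw [← map_pow, ZMod.pow_card]

theorem charP_of_zmod_algebra (p : ℕ) [Fact p.Prime] (K : Type*) [Field K] [Algebra (ZMod p) K] :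
    CharP K p :=
  charP_of_injective_algebraMap (algebraMap (ZMod p) K).injective p

namespace QuadraticGenerator

theorem ne_zero [Fintype K] (hq : QuadraticGenerator p α β) : α ≠ 0 := by
  rintro rfl
  exact hq.notMem ⟨0, map_zero _⟩

theorem two_ne_zero [Fintype K] (hq : QuadraticGenerator p α β) : (2 : K) ≠ 0 := by
  have := charP_of_zmod_algebra p K
  intro h
  have h2 : ((2 : ℕ) : K) = 0 := by exact_mod_cast h
  rw [CharP.cast_eq_zero_iff K p, Nat.dvd_prime Nat.prime_two] at h2
  have := hq.odd
  have := (Fact.out : p.Prime).one_lt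
  rcases h2 with rfl | rfl
  · omega
  · exact absurd hq.odd (by decide)

theorem pow_char [Fintype K] (hq : QuadraticGenerator p α β) : α ^ p = -α := by
  have hβ : β ≠ 0 := by
    rintro rfl
    exact hq.ne_zero (by simpa using hq.sq)
  have hp : p = 2 * (p / 2) + 1 := by
    obtain ⟨k, hk⟩ := hq.odd
    omega
  have h : α ^ p = algebraMap (ZMod p) K (β ^ (p / 2)) * α := by
    conv_lhs => rw [hp, pow_succ, pow_mul, hq.sq, ← map_pow]
  rcases ZMod.pow_div_two_eq_neg_one_or_one p hβ with h1 | h1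
  · obtain ⟨y, hy⟩ := (ZMod.euler_criterion p hβ).mpr h1
    have : α ^ 2 = algebraMap (ZMod p) K y ^ 2 := by rw [hq.sq, hy, map_mul, pow_two]
    rcases sq_eq_sq_iff_eq_or_eq_neg.mp this with h2 | h2
    · exact absurd ⟨y, h2.symm⟩ hq.notMem
    · exact absurd ⟨-y, by rw [h2, map_neg]⟩ hq.notMem
  · rw [h, h1]
    simp

theorem eq_zero_of_add_mul_eq_zero [Fintype K] (hq : QuadraticGenerator p α β) {b d : ZMod p}
    (h : algebraMap (ZMod p) K b + algebraMap (ZMod p) K d * α = 0) : b = 0 ∧ d = 0 := by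
  have hd : d = 0 := by
    by_contra hd
    have hd' : algebraMap (ZMod p) K d ≠ 0 := by simpa using hd
    refine hq.notMem ⟨-(b / d), ?_⟩
    rw [map_neg, map_div₀]
    field_simp
    linear_combination -h
  subst hd
  simpa using h

end QuadraticGenerator

/-- The coordinates of the row vector `(1, α) * g`. -/
noncomputable def rowCoord (α : K) (g : GL (Fin 2) (ZMod p)) (j : Fin 2) : K :=
  algebraMap (ZMod p) K (g.val 0 j) + algebraMap (ZMod p) K (g.val 1 j) * α

/-- The anisotropic torus of `GL₂(𝔽_p)` attached to `β`. -/
def anisotropicTorus (p : ℕ) [Fact p.Prime] (β : ZMod p) : Subgroup (GL (Fin 2) (ZMod p)) where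
  carrier := {t | Commute t.val !![0, β; 1, 0]}
  mul_mem' := fun ha hb => by
    simpa using Commute.mul_left ha hb
  one_mem' := by simp
  inv_mem' := fun ha => Commute.units_inv_left ha

noncomputable instance fintypeAnisotropicTorus (p : ℕ) [Fact p.Prime] (β : ZMod p) :
    Fintype (anisotropicTorus p β) :=
  Fintype.ofFinite _

theorem mem_anisotropicTorus {t : GL (Fin 2) (ZMod p)} :
    t ∈ anisotropicTorus p β ↔ t.val = !![t.val 0 0, t.val 1 0 * β; t.val 1 0, t.val 0 0] := by
  change t.val * !![0, β; 1, 0] = !![0, β; 1, 0] * t.val ↔ _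
  conv_lhs => rw [Matrix.eta_fin_two t.val, Matrix.mul_fin_two, Matrix.mul_fin_two]
  conv_rhs => lhs; rw [Matrix.eta_fin_two t.val]
  simp only [← Matrix.ext_iff, Fin.forall_fin_two]
  simp
  constructor
  · rintro ⟨⟨h1, h2⟩, h3, h4⟩
    exact ⟨by rw [h1, mul_comm], h3⟩
  · rintro ⟨h1, h2⟩
    rw [h1, h2]
    exact ⟨⟨mul_comm _ _, mul_comm _ _⟩, rfl, rfl⟩

theorem mem_anisotropicTorus_of_eq {t : GL (Fin 2) (ZMod p)} {u v : ZMod p}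
    (h : t.val = !![u, v * β; v, u]) : t ∈ anisotropicTorus p β := by
  rw [mem_anisotropicTorus, h]
  simp

theorem rowCoord_mul [Fintype K] (hq : QuadraticGenerator p α β) {t : GL (Fin 2) (ZMod p)}
    (ht : t ∈ anisotropicTorus p β) (g : GL (Fin 2) (ZMod p)) (j : Fin 2) :
    rowCoord α (t * g) j = rowCoord α t 0 * rowCoord α g j := by
  rw [mem_anisotropicTorus] at ht
  have h1 : t.val 0 1 = t.val 1 0 * β := by rw [ht]; simp
  have h2 : t.val 1 1 = t.val 0 0 := by rw [ht]; simp
  simp only [rowCoord, Units.val_mul, Matrix.mul_apply, Fin.sum_univ_two, h1, h2, map_add, map_mul,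
    ← hq.sq]
  ring

theorem rowCoord_one_zero : rowCoord α (1 : GL (Fin 2) (ZMod p)) 0 = 1 := by
  simp [rowCoord]

theorem rowCoord_ne_zero [Fintype K] (hq : QuadraticGenerator p α β) (g : GL (Fin 2) (ZMod p)) :
    rowCoord α g 0 ≠ 0 := by
  intro h
  obtain ⟨h0, h1⟩ := hq.eq_zero_of_add_mul_eq_zero h
  have := (Matrix.isUnit_iff_isUnit_det _).mp g.isUnit
  rw [Matrix.det_fin_two, h0, h1] at this
  simp at this

/-- The character `ω₂` of the anisotropic torus. -/
noncomputable def torusChar [Fintype K] (hq : QuadraticGenerator p α β) :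
    anisotropicTorus p β →* K where
  toFun t := rowCoord α t.val 0
  map_one' := rowCoord_one_zero
  map_mul' s t := rowCoord_mul hq s.2 t.val 0

theorem torusChar_apply [Fintype K] (hq : QuadraticGenerator p α β) (t : anisotropicTorus p β) :
    torusChar hq t = rowCoord α t.val 0 := rfl

theorem rowCoord_zero_pow_char [Fintype K] (hq : QuadraticGenerator p α β)
    (t : GL (Fin 2) (ZMod p)) :
    rowCoord α t 0 ^ p = algebraMap (ZMod p) K (t.val 0 0) - algebraMap (ZMod p) K (t.val 1 0) * α
    := by
  have := charP_of_zmod_algebra p K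
  rw [rowCoord, add_pow_char, mul_pow, hq.pow_char, algebraMap_pow_char, algebraMap_pow_char]
  ring

theorem algebraMap_det_torus [Fintype K] (hq : QuadraticGenerator p α β)
    {t : GL (Fin 2) (ZMod p)} (ht : t ∈ anisotropicTorus p β) :
    algebraMap (ZMod p) K t.val.det = rowCoord α t 0 ^ (p + 1) := by
  rw [pow_succ, rowCoord_zero_pow_char hq t, rowCoord]
  rw [mem_anisotropicTorus] at ht
  have h1 : t.val 0 1 = t.val 1 0 * β := by rw [ht]; simp
  have h2 : t.val 1 1 = t.val 0 0 := by rw [ht]; simp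
  simp only [Matrix.det_fin_two, h1, h2, map_sub, map_mul, ← hq.sq]
  ring

theorem torusChar_injective [Fintype K] (hq : QuadraticGenerator p α β) :
    Function.Injective (torusChar hq) := by
  rintro ⟨s, hs⟩ ⟨t, ht⟩ h
  simp only [torusChar_apply, rowCoord] at h
  obtain ⟨h1, h2⟩ := hq.eq_zero_of_add_mul_eq_zero (b := s.val 0 0 - t.val 0 0)
    (d := s.val 1 0 - t.val 1 0) (by rw [map_sub, map_sub]; linear_combination h)
  rw [mem_anisotropicTorus] at hs ht
  ext1
  apply Units.ext
  dsimp only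
  rw [hs, ht, sub_eq_zero.mp h1, sub_eq_zero.mp h2]

theorem card_torus_ne_zero [Fintype K] (hq : QuadraticGenerator p α β) :
    (Fintype.card (anisotropicTorus p β) : K) ≠ 0 := by
  have := charP_of_zmod_algebra p K
  have hp := (Fact.out : p.Prime).one_lt
  rw [Ne, CharP.cast_eq_zero_iff K p]
  intro h
  have hinj : Function.Injective (torusChar hq).toHomUnits := fun s t hst =>
    torusChar_injective hq (congr_arg Units.val hst)
  have h2 := Subgroup.card_dvd_of_injective _ hinj
  rw [Nat.card_eq_fintype_card, Nat.card_units, Nat.card_eq_fintype_card, hq.card] at h2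
  have h3 := h.trans h2
  have h4 : p ∣ p ^ 2 := dvd_pow_self p (by norm_num)
  have h5 : p ^ 2 - (p ^ 2 - 1) = 1 := Nat.sub_sub_self (Nat.one_le_pow _ _ (by omega))
  have := Nat.dvd_sub h4 h3
  rw [h5, Nat.dvd_one] at this
  omega

end NonsplitTorus

section Covariance

variable {p : ℕ} [Fact p.Prime] {K : Type*} [Field K] [Algebra (ZMod p) K]
  {α : K} {β : ZMod p}

/-- A linear functional whose restriction to `A` is an `ω₂^e`-eigenvector of the torus. -/
def IsCovariantOn (α : K) (β : ZMod p) (e : ℕ)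
    (A : Submodule K (MvPolynomial (Fin 2 × Fin 2) K))
    (φ : MvPolynomial (Fin 2 × Fin 2) K →ₗ[K] K) : Prop :=
  ∀ t ∈ anisotropicTorus p β, ∀ R ∈ A, φ (actK p K t.val R) = rowCoord α t 0 ^ e * φ R

/-- The space of functions underlying `ind_T^G ω₂^e`. -/
def inducedFunctions (α : K) (β : ZMod p) (e : ℕ) : Submodule K (GL (Fin 2) (ZMod p) → K) where
  carrier := {h | ∀ t ∈ anisotropicTorus p β, ∀ g, h (t * g) = rowCoord α t 0 ^ e * h g}
  add_mem' := fun ha hb t ht g => by rw [Pi.add_apply, ha t ht, hb t ht, Pi.add_apply, mul_add]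
  zero_mem' := fun t ht g => by simp
  smul_mem' := fun c h hh t ht g => by
    rw [Pi.smul_apply, hh t ht, Pi.smul_apply, smul_eq_mul, smul_eq_mul, mul_left_comm]

/-- Any functional that is covariant on a torus-stable submodule agrees there with a functional
that is covariant everywhere. -/
theorem exists_isCovariantOn_top [Fintype K] (hq : QuadraticGenerator p α β) {e : ℕ}
    {A : Submodule K (MvPolynomial (Fin 2 × Fin 2) K)}
    {φ : MvPolynomial (Fin 2 × Fin 2) K →ₗ[K] K} (hφ : IsCovariantOn α β e A φ) :
    ∃ φ' : MvPolynomial (Fin 2 × Fin 2) K →ₗ[K] K, IsCovariantOn α β e ⊤ φ' ∧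
      ∀ R ∈ A, φ' R = φ R := by
  refine ⟨(Fintype.card (anisotropicTorus p β) : K)⁻¹ • ∑ t : anisotropicTorus p β,
    (torusChar hq t ^ e)⁻¹ • (φ ∘ₗ actK p K t.val.val), fun s hs R _ => ?_, fun R hR => ?_⟩
  · simp only [LinearMap.smul_apply, LinearMap.sum_apply, LinearMap.comp_apply, smul_eq_mul]
    rw [mul_left_comm]
    congr 1
    rw [Finset.mul_sum]
    refine Fintype.sum_equiv (Equiv.mulRight (⟨s, hs⟩ : anisotropicTorus p β)) _ _ fun t => ?_
    have h0 := rowCoord_ne_zero hq s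
    have h1 := rowCoord_ne_zero hq t.val
    rw [Equiv.coe_mulRight, map_mul, torusChar_apply, torusChar_apply, Subgroup.coe_mul,
      Units.val_mul, actK_mul_apply]
    field_simp
    ring
  · simp only [LinearMap.smul_apply, LinearMap.sum_apply, LinearMap.comp_apply, smul_eq_mul]
    rw [Finset.sum_congr rfl fun t _ => ?_, Finset.sum_const, Finset.card_univ, nsmul_eq_mul,
      inv_mul_cancel_left₀ (card_torus_ne_zero hq)]
    rw [hφ t.val t.2 R hR, torusChar_apply,
      inv_mul_cancel_left₀ (pow_ne_zero _ (rowCoord_ne_zero hq _))]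

/-- The matrix coefficient map `R ↦ (g ↦ φ (g R))`. -/
noncomputable def orbitMap (p : ℕ) [Fact p.Prime] [Algebra (ZMod p) K]
    (φ : MvPolynomial (Fin 2 × Fin 2) K →ₗ[K] K) :
    MvPolynomial (Fin 2 × Fin 2) K →ₗ[K] (GL (Fin 2) (ZMod p) → K) :=
  LinearMap.pi fun g => φ ∘ₗ actK p K g.val

theorem orbitMap_apply (φ : MvPolynomial (Fin 2 × Fin 2) K →ₗ[K] K)
    (R : MvPolynomial (Fin 2 × Fin 2) K) (g : GL (Fin 2) (ZMod p)) :
    orbitMap p φ R g = φ (actK p K g.val R) := rfl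

theorem orbitMap_mem {e : ℕ} {A : Submodule K (MvPolynomial (Fin 2 × Fin 2) K)}
    {φ : MvPolynomial (Fin 2 × Fin 2) K →ₗ[K] K} (hφ : IsCovariantOn α β e A φ)
    {R : MvPolynomial (Fin 2 × Fin 2) K}
    (hA : ∀ g : GL (Fin 2) (ZMod p), actK p K g.val R ∈ A) :
    orbitMap p φ R ∈ inducedFunctions α β e := by
  intro t ht g
  rw [orbitMap_apply, Units.val_mul, actK_mul_apply, hφ t ht _ (hA g), orbitMap_apply]

/-- The element `[[1, b], [0, d]]` of the mirabolic subgroup. -/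
noncomputable def mirabolic (x : ZMod p × (ZMod p)ˣ) : GL (Fin 2) (ZMod p) :=
  Matrix.GeneralLinearGroup.mkOfDetNeZero !![1, x.1; 0, (x.2 : ZMod p)] (by
    simp [Matrix.det_fin_two])

theorem mirabolic_val (x : ZMod p × (ZMod p)ˣ) :
    (mirabolic x).val = !![1, x.1; 0, (x.2 : ZMod p)] := rfl

theorem exists_torus_mul_mirabolic [Fintype K] (hq : QuadraticGenerator p α β)
    (g : GL (Fin 2) (ZMod p)) :
    ∃ t ∈ anisotropicTorus p β, ∃ x, g = t * mirabolic x := by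
  have hdet : (!![g.val 0 0, g.val 1 0 * β; g.val 1 0, g.val 0 0]).det ≠ 0 := by
    intro h
    rw [Matrix.det_fin_two] at h
    simp only [Matrix.of_apply, Matrix.cons_val', Matrix.cons_val_zero, Matrix.cons_val_one,
      Matrix.cons_val_fin_one] at h
    have h0 := rowCoord_ne_zero hq g
    have h1 : rowCoord α g 0 * (algebraMap (ZMod p) K (g.val 0 0) +
        algebraMap (ZMod p) K (-g.val 1 0) * α) = 0 := by
      have := congr_arg (algebraMap (ZMod p) K) h
      simp only [map_sub, map_mul, map_zero, ← hq.sq] at this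
      rw [rowCoord, map_neg]
      linear_combination this
    obtain ⟨h2, h3⟩ := hq.eq_zero_of_add_mul_eq_zero ((mul_eq_zero.mp h1).resolve_left h0)
    rw [neg_eq_zero] at h3
    exact h0 (by simp [rowCoord, h2, h3])
  set t := Matrix.GeneralLinearGroup.mkOfDetNeZero _ hdet with ht
  have htv : t.val = !![g.val 0 0, g.val 1 0 * β; g.val 1 0, g.val 0 0] := rfl
  refine ⟨t, mem_anisotropicTorus_of_eq htv, ?_⟩
  set k := t⁻¹ * g with hk
  have hg : g = t * k := by rw [hk, mul_inv_cancel_left]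
  have hrow := rowCoord_mul (α := α) hq (mem_anisotropicTorus_of_eq htv) k 0
  rw [← hg] at hrow
  have htg : rowCoord α t 0 = rowCoord α g 0 := by simp [rowCoord, htv]
  have h1 : rowCoord α k 0 = 1 := by
    rw [htg] at hrow
    exact mul_left_cancel₀ (rowCoord_ne_zero hq g) (by rw [← hrow, mul_one])
  obtain ⟨h2, h3⟩ := hq.eq_zero_of_add_mul_eq_zero (b := k.val 0 0 - 1) (d := k.val 1 0) (by
    rw [map_sub, map_one]
    rw [rowCoord] at h1
    linear_combination h1)
  rw [sub_eq_zero] at h2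
  have hu : k.val 1 1 ≠ 0 := by
    intro h
    have := (Matrix.isUnit_iff_isUnit_det _).mp k.isUnit
    rw [Matrix.det_fin_two, h3, h] at this
    simp at this
  refine ⟨(k.val 0 1, Units.mk0 _ hu), ?_⟩
  rw [hg]
  congr 1
  apply Units.ext
  rw [mirabolic_val, Units.val_mk0]
  exact (Matrix.eta_fin_two k.val).trans (by rw [h2, h3])

theorem inducedFunctions_ext [Fintype K] (hq : QuadraticGenerator p α β) {e : ℕ}
    {h₁ h₂ : GL (Fin 2) (ZMod p) → K} (hh₁ : h₁ ∈ inducedFunctions α β e)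
    (hh₂ : h₂ ∈ inducedFunctions α β e) (h : ∀ x, h₁ (mirabolic x) = h₂ (mirabolic x)) :
    h₁ = h₂ := by
  funext g
  obtain ⟨t, ht, x, rfl⟩ := exists_torus_mul_mirabolic hq g
  rw [hh₁ t ht, hh₂ t ht, h]

end Covariance

section SerreOperatorPowers

variable {p : ℕ} {K : Type*} [Field K]

theorem DK_pow_X_pow [Fact p.Prime] [CharP K p] (j k : ℕ) :
    (DK p K ^ j) (X (0, 0) ^ k) =
      (k.descFactorial j : K) • (X (0, 0) ^ (k + j * (p - 1)) :
        MvPolynomial (Fin 2 × Fin 2) K) := by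
  have hp := (Fact.out : p.Prime).one_lt
  induction j with
  | zero => simp
  | succ j ih =>
    rw [pow_succ', Module.End.mul_apply, ih, map_smul, DK_pow, DK_X_zero, Nat.descFactorial_succ]
    rcases lt_or_ge k j with hkj | hkj
    · rw [Nat.descFactorial_of_lt hkj]
      simp
    rcases Nat.eq_zero_or_pos k with rfl | hk
    · obtain rfl : j = 0 := by omega
      simp
    have h1 : ((k + j * (p - 1) : ℕ) : MvPolynomial (Fin 2 × Fin 2) K) = C ((k - j : ℕ) : K) := by
      rw [← map_natCast (C : K →+* MvPolynomial (Fin 2 × Fin 2) K)]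
      congr 1
      have : k + j * (p - 1) = (k - j) + j * p := by
        zify [hkj, hp.le]
        ring
      rw [this, Nat.cast_add, Nat.cast_mul, CharP.cast_eq_zero K p, mul_zero, add_zero]
    have h2 : k + (j + 1) * (p - 1) = k + j * (p - 1) - 1 + p := by
      rw [add_mul]
      omega
    rw [h1, h2, pow_add, Nat.cast_mul, smul_eq_C_mul, smul_eq_C_mul, map_mul]
    ring

theorem X_pow_mul_DK_pow_quadMonomial [Fact p.Prime] [CharP K p] (j a b c d : ℕ) :
    X (0, 0) ^ (p * b) * (DK p K ^ j) (quadMonomial K a b c d) =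
      ∑ l ∈ Finset.range (b + 1), ((a + l).descFactorial j * b.choose l : K) •
        (dickson p K ^ (b - l) * quadMonomial K (a + l + j * (p - 1)) (p * l) c d) := by
  have hX (v : Fin 2 × Fin 2) (k : ℕ) : DK p K (X v ^ (p * k)) = 0 := by
    rw [pow_mul]
    exact DK_pow_const (DK_pow_char _) _
  have hS (k : ℕ) (j : Fin 2) : DK p K (X (1, j) ^ k) = 0 := DK_pow_const (DK_X_one _) _
  rw [← DK_pow_mul_of_eq_zero (hX _ _)]
  have h1 : X (0, 0) ^ (p * b) * quadMonomial K a b c d =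
      ∑ l ∈ Finset.range (b + 1), (X (1, 0) ^ c * X (1, 1) ^ d * C (b.choose l : K) *
        dickson p K ^ (b - l) * X (0, 1) ^ (p * l)) * X (0, 0) ^ (a + l) := by
    have h2 : (X (0, 0) ^ (p * b) * X (0, 1) ^ b : MvPolynomial (Fin 2 × Fin 2) K) =
        (X (0, 0) * X (0, 1) ^ p + dickson p K) ^ b := by
      rw [dickson, pow_mul, ← mul_pow]
      ring
    have h3 : X (0, 0) ^ (p * b) * quadMonomial K a b c d =
        X (0, 0) ^ a * (X (0, 0) ^ (p * b) * X (0, 1) ^ b) * (X (1, 0) ^ c * X (1, 1) ^ d) := by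
      rw [quadMonomial]
      ring
    rw [h3, h2, add_pow, Finset.mul_sum, Finset.sum_mul]
    refine Finset.sum_congr rfl fun l _ => ?_
    rw [map_natCast, pow_add, pow_mul, mul_pow]
    ring
  rw [h1, map_sum]
  refine Finset.sum_congr rfl fun l _ => ?_
  rw [DK_pow_mul_of_eq_zero, DK_pow_X_pow, quadMonomial]
  · simp only [smul_eq_C_mul, map_mul]
    ring
  · exact DK_mul_const (DK_mul_const (DK_mul_const (DK_mul_const (hS _ _) (hS _ _)) (DK_C _))
      (DK_pow_const DK_dickson _)) (hX _ _)

theorem DK_pow_quadMonomial_eq_zero [Fact p.Prime] [CharP K p] (j a b c d : ℕ)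
    (h : ∀ l ≤ b, (((a + l).descFactorial j : ℕ) : K) = 0) :
    (DK p K ^ j) (quadMonomial K a b c d) = 0 := by
  refine (mul_eq_zero.mp ((X_pow_mul_DK_pow_quadMonomial j a b c d).trans ?_)).resolve_left
    (pow_ne_zero (p * b) (X_ne_zero _))
  refine Finset.sum_eq_zero fun l hl => ?_
  rw [h l (by rw [Finset.mem_range] at hl; omega), zero_mul, zero_smul]

theorem DK_pow_char_apply [Fact p.Prime] [CharP K p] {k : ℕ}
    {R : MvPolynomial (Fin 2 × Fin 2) K} (hR : R ∈ biHom p K k) : (DK p K ^ p) R = 0 := by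
  suffices h : biHom p K k ≤ LinearMap.ker (DK p K ^ p) from h hR
  refine biHom_le fun a b c d _ _ => DK_pow_quadMonomial_eq_zero _ _ _ _ _ fun l _ => ?_
  rw [CharP.cast_eq_zero_iff K p]
  exact (Nat.dvd_factorial (Fact.out : p.Prime).pos le_rfl).trans
    (Nat.factorial_dvd_descFactorial _ _)

theorem DK_pow_eq_zero_of_lt [Fact p.Prime] [CharP K p] {k j : ℕ} (hk : k ≤ j)
    {R : MvPolynomial (Fin 2 × Fin 2) K} (hR : R ∈ biHom p K k) : (DK p K ^ j) R = 0 := by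
  suffices h : biHom p K k ≤ LinearMap.ker (DK p K ^ j) from h hR
  refine biHom_le fun a b c d _ _ => DK_pow_quadMonomial_eq_zero _ _ _ _ _ fun l _ => ?_
  rw [Nat.descFactorial_of_lt (by omega), Nat.cast_zero]

theorem DK_pow_mem_biHom {k : ℕ} (hp : 0 < p) (j : ℕ) {R : MvPolynomial (Fin 2 × Fin 2) K}
    (hR : R ∈ biHom p K k) : (DK p K ^ j) R ∈ biHom p K (k + j * (p - 1)) := by
  induction j with
  | zero => simpa using hR
  | succ j ih =>
    rw [pow_succ', Module.End.mul_apply]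
    convert DK_mem_biHom ih using 2
    rw [add_mul]
    omega

theorem descFactorial_pred_cast_eq_zero [Fact p.Prime] [CharP K p] {k : ℕ} (hk : k ≠ p - 1)
    (hk' : k + 1 < 2 * p) : ((k.descFactorial (p - 1) : ℕ) : K) = 0 := by
  have hp := (Fact.out : p.Prime).pos
  rcases lt_or_ge k (p - 1) with h | h
  · rw [Nat.descFactorial_of_lt h, Nat.cast_zero]
  rw [CharP.cast_eq_zero_iff K p]
  have h1 : p ∣ k.factorial := Nat.dvd_factorial hp (by omega)
  rw [← Nat.factorial_mul_descFactorial h] at h1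
  refine ((Fact.out : p.Prime).dvd_mul.mp h1).resolve_left fun h2 => ?_
  rw [(Fact.out : p.Prime).dvd_factorial] at h2
  omega

/-- The explicit form of `D^{p-1}` on monomials of degree `p - 1 + q` with `q < p`. -/
theorem DK_pow_pred_quadMonomial [Fact p.Prime] [CharP K p] {q a b : ℕ} (hq : 1 ≤ q)
    (hab : a + b + q + 1 = p) (c d : ℕ) :
    (DK p K ^ (p - 1)) (quadMonomial K (p - 1 - b) (p - 1 - a) c d) =
      ((p - 1).factorial * (p - 1 - a).choose b : K) •
        (dickson p K ^ q * quadMonomial K (p * a) (p * b) c d) := by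
  have hp := (Fact.out : p.Prime).two_le
  apply mul_left_cancel₀ (pow_ne_zero (p * (p - 1 - a)) (X_ne_zero ((0, 0) : Fin 2 × Fin 2)))
  rw [X_pow_mul_DK_pow_quadMonomial, Finset.sum_eq_single b]
  · have h1 : p - 1 - b + b = p - 1 := by omega
    have h2 : p - 1 - a - b = q := by omega
    have h3 : p - 1 + (p - 1) * (p - 1) = p * (p - 1 - a) + p * a := by
      have h4 : p - 1 - a + a = p - 1 := by omega
      rw [← mul_add, h4]
      obtain ⟨n, rfl⟩ : ∃ n, p = n + 1 := ⟨p - 1, by omega⟩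
      simp only [Nat.add_sub_cancel]
      ring
    rw [h1, h2, h3, Nat.descFactorial_self, mul_smul_comm]
    congr 1
    simp only [quadMonomial, pow_add]
    ring
  · intro l hl hlb
    rw [Finset.mem_range] at hl
    rw [descFactorial_pred_cast_eq_zero (by omega) (by omega), zero_mul, zero_smul]
  · intro h
    rw [Finset.mem_range] at h
    omega

end SerreOperatorPowers

section Evaluation

variable {p : ℕ} {K : Type*} [Field K]

/-- Evaluation at `(X, Y) = z`, `(S, T) = w`. -/
noncomputable def evalRows (z w : Fin 2 → K) : MvPolynomial (Fin 2 × Fin 2) K →ₐ[K] K :=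
  aeval fun v => (![z, w] v.1) v.2

theorem evalRows_quadMonomial (z w : Fin 2 → K) (a b c d : ℕ) :
    evalRows z w (quadMonomial K a b c d) = z 0 ^ a * z 1 ^ b * w 0 ^ c * w 1 ^ d := by
  simp [evalRows, quadMonomial]

theorem evalRows_dickson (z w : Fin 2 → K) :
    evalRows z w (dickson p K) = z 0 ^ p * z 1 - z 0 * z 1 ^ p := by
  simp [evalRows, dickson]

theorem evalRows_smul {k : ℕ} {R : MvPolynomial (Fin 2 × Fin 2) K} (hR : R ∈ biHom p K k)
    (c d : K) (z w : Fin 2 → K) :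
    evalRows (c • z) (d • w) R = c ^ (k - 1) * d ^ (p - 1) * evalRows z w R := by
  suffices h : biHom p K k ≤ LinearMap.eqLocus (evalRows (c • z) (d • w)).toLinearMap
      ((c ^ (k - 1) * d ^ (p - 1)) • (evalRows z w).toLinearMap) from h hR
  refine biHom_le fun a b c' d' hab hcd => ?_
  have h1 : k - 1 = a + b := by omega
  have h2 : p - 1 = c' + d' := by omega
  simp only [LinearMap.mem_eqLocus, AlgHom.toLinearMap_apply, LinearMap.smul_apply,
    evalRows_quadMonomial, Pi.smul_apply, smul_eq_mul, h1, h2]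
  ring

theorem evalRows_actK [Fact p.Prime] [Algebra (ZMod p) K] (a b : K) (g : GL (Fin 2) (ZMod p))
    (R : MvPolynomial (Fin 2 × Fin 2) K) :
    evalRows ![1, a] ![1, b] (actK p K g.val R) = evalRows (rowCoord a g) (rowCoord b g) R := by
  rw [actK_apply, ← AlgHom.comp_apply]
  congr 1
  apply MvPolynomial.algHom_ext
  rintro ⟨i, j⟩
  rw [AlgHom.comp_apply, substHom_X]
  fin_cases i <;> simp [evalRows, rowCoord]

theorem rowCoord_one [Fact p.Prime] [Algebra (ZMod p) K] (a : K) :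
    rowCoord a (1 : GL (Fin 2) (ZMod p)) = ![1, a] := by
  funext j
  fin_cases j <;> simp [rowCoord]

variable [Fact p.Prime] [Algebra (ZMod p) K] [Fintype K] {α : K} {β : ZMod p}

theorem rowCoord_neg (hq : QuadraticGenerator p α β) (g : GL (Fin 2) (ZMod p)) (j : Fin 2) :
    rowCoord (-α) g j = rowCoord α g j ^ p := by
  have := charP_of_zmod_algebra p K
  rw [rowCoord, rowCoord, add_pow_char, mul_pow, hq.pow_char, algebraMap_pow_char,
    algebraMap_pow_char]

theorem rowCoord_neg_mul (hq : QuadraticGenerator p α β) {t : GL (Fin 2) (ZMod p)}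
    (ht : t ∈ anisotropicTorus p β) (g : GL (Fin 2) (ZMod p)) (j : Fin 2) :
    rowCoord (-α) (t * g) j = rowCoord α t 0 ^ p * rowCoord (-α) g j := by
  rw [rowCoord_neg hq, rowCoord_mul hq ht, mul_pow, rowCoord_neg hq]

theorem rowCoord_torus (hq : QuadraticGenerator p α β) {t : GL (Fin 2) (ZMod p)}
    (ht : t ∈ anisotropicTorus p β) : rowCoord α t = rowCoord α t 0 • ![1, α] := by
  funext j
  conv_lhs => rw [← mul_one t, rowCoord_mul hq ht, rowCoord_one]
  rfl

/-- Powers of elements of `𝔽_{p²}` only depend on the exponent modulo `p² - 1`. -/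
theorem QuadraticGenerator.pow_eq_pow (hq : QuadraticGenerator p α β) {x : K} (hx : x ≠ 0)
    {m n : ℕ} (h : m + 1 = n + p ^ 2) : x ^ m = x ^ n := by
  have h1 := FiniteField.pow_card_sub_one_eq_one x hx
  rw [hq.card] at h1
  have h2 := Nat.one_le_pow 2 p (Fact.out : p.Prime).pos
  have h3 : m = n + (p ^ 2 - 1) := by omega
  rw [h3, pow_add, h1, mul_one]

end Evaluation

section SpanOfFunctions

/-- In a commutative algebra of characteristic `p` containing `x` and `e` with `x ^ p = x + e` and
`e ^ (p - 1) = -1`, two families of products of `x`, `x + e` and `e` span all powers of `x`. -/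
theorem pow_mem_of_mul_mem {K A : Type*} [Field K] [CommRing A] [Algebra K A] {p q : ℕ}
    [Fact p.Prime] [CharP A p] {x y e : A} (hxy : y = x + e) (hx : x ^ p = y)
    (he : e ^ (p - 1) = -1) (hq : 1 ≤ q) (hqp : q < p) (W : Submodule K A)
    (h1 : ∀ b j, b + 2 ≤ q → j < p → e * x ^ b * y ^ j ∈ W)
    (h2 : ∀ b j, b + q + 1 ≤ p → j < p → e ^ q * y ^ b * x ^ j ∈ W) (n : ℕ) : x ^ n ∈ W := by
  have hp := (Fact.out : p.Prime).two_le
  have hep : e ^ p = -e := by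
    conv_lhs => rw [← Nat.sub_add_cancel (by omega : 1 ≤ p), pow_succ, he]
    ring
  have hy : y ^ p = x := by
    rw [hxy, add_pow_char, hx, hep, hxy]
    ring
  have key (x y c e : A) (N : ℕ) (hxy : y = x + e ∨ y = x - e) (hy : y ^ p = x) :
      ∀ a ≤ N, ∀ j < p, (∀ b j, b ≤ N → j < p → c * x ^ b * y ^ j ∈ W) →
        ∀ i, a + i ≤ N → c * e ^ a * x ^ i * y ^ j ∈ W := by
    intro a
    induction a with
    | zero =>
      intro _ j hj h i hi
      simpa using h i j (by omega) hj
    | succ a ih =>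
      intro ha j hj h i hi
      have h3 : c * e ^ a * x ^ (i + 1) * y ^ j ∈ W :=
        ih (by omega) j hj h (i + 1) (by omega)
      have h4 : c * e ^ a * x ^ i * y ^ (j + 1) ∈ W := by
        rcases Nat.lt_or_ge (j + 1) p with hj' | hj'
        · exact ih (by omega) (j + 1) hj' h i (by omega)
        · have : y ^ (j + 1) = x := by rw [← hy]; congr 1; omega
          rw [this, mul_assoc, ← pow_succ]
          simpa using ih (by omega) 0 (by omega) h (i + 1) (by omega)
      rcases hxy with rfl | rfl
      · have := W.sub_mem h4 h3
        convert this using 1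
        ring
      · have := W.sub_mem h3 h4
        convert this using 1
        ring
  have hA : ∀ a, 1 ≤ a → a < q → ∀ j < p, e ^ a * y ^ j ∈ W := fun a ha haq j hj => by
    have := key x y e e (q - 2) (Or.inl hxy) hy (a - 1) (by omega) j hj
      (fun b j hb hj => h1 b j (by omega) hj) 0 (by omega)
    rw [pow_zero, mul_one, ← pow_succ', Nat.sub_add_cancel ha] at this
    exact this
  have hB : ∀ a, q ≤ a → a < p → ∀ j < p, e ^ a * x ^ j ∈ W := fun a ha hap j hj => by
    have := key y x (e ^ q) e (p - 1 - q) (Or.inr (by rw [hxy]; ring)) hx (a - q) (by omega) j hj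
      (fun b j hb hj => h2 b j (by omega) hj) 0 (by omega)
    rw [pow_zero, mul_one, ← pow_add, Nat.add_sub_cancel' ha] at this
    exact this
  have hC : ∀ a, 1 ≤ a → ∀ j < p, e ^ a * y ^ j ∈ W ∨ e ^ a * x ^ j ∈ W := by
    intro a
    induction a using Nat.strong_induction_on with
    | _ a ih =>
      intro ha j hj
      rcases lt_or_ge a p with hap | hap
      · rcases lt_or_ge a q with h | h
        · exact Or.inl (hA a ha h j hj)
        · exact Or.inr (hB a h hap j hj)
      · have h3 : e ^ a = -e ^ (a - (p - 1)) := by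
          conv_lhs => rw [← Nat.sub_add_cancel (by omega : p - 1 ≤ a), pow_add, he]
          ring
        simp only [h3, neg_mul, W.neg_mem_iff]
        exact ih _ (by omega) (by omega) j hj
  have hD : ∀ j < p, ∀ a, 1 ≤ a → e ^ a * x ^ j ∈ W := by
    intro j
    induction j using Nat.strong_induction_on with
    | _ j ih =>
      intro hj a ha
      rcases hC a ha j hj with h | h
      · rw [hxy, add_pow, Finset.sum_range_succ, mul_add, Finset.mul_sum] at h
        have h3 : ∑ i ∈ Finset.range j, e ^ a * (x ^ i * e ^ (j - i) * (j.choose i : A)) ∈ W := by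
          refine W.sum_mem fun i hi => ?_
          rw [Finset.mem_range] at hi
          have := W.smul_mem (j.choose i : K) (ih i hi (by omega) (a + (j - i)) (by omega))
          rw [Algebra.smul_def, map_natCast] at this
          convert this using 1
          ring
        have h4 := W.sub_mem h h3
        simpa using h4
      · exact h
  have hE : ∀ n a, 1 ≤ a → e ^ a * x ^ n ∈ W := by
    intro n
    induction n using Nat.strong_induction_on with
    | _ n ih =>
      intro a ha
      rcases lt_or_ge n p with hn | hn
      · exact hD n hn a ha
      · have h3 : x ^ n = x ^ (n - p + 1) + e * x ^ (n - p) := by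
          conv_lhs => rw [← Nat.sub_add_cancel hn, pow_add, hx, hxy]
          ring
        rw [h3, mul_add, ← mul_assoc, ← pow_succ]
        exact W.add_mem (ih _ (by omega) a ha) (ih _ (by omega) (a + 1) (by omega))
  have := hE n (p - 1) (by omega)
  rw [he] at this
  simpa using this

end SpanOfFunctions

section PairDomain

variable {p : ℕ} {K : Type*} [Field K]

/-- The domain on which `pairMap` is an isomorphism. -/
noncomputable def pairDomain (p : ℕ) (K : Type*) [Field K] (q : ℕ) :
    Submodule K (MvPolynomial (Fin 2 × Fin 2) K × MvPolynomial (Fin 2 × Fin 2) K) :=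
  (biHom p K (q - 1)).prod (biHom p K (p - q))

/-- `pairDomain` as a product of modules. -/
noncomputable def pairDomainEquiv (p : ℕ) (K : Type*) [Field K] (q : ℕ) :
    pairDomain p K q ≃ₗ[K] biHom p K (q - 1) × biHom p K (p - q) where
  toFun x := (⟨x.1.1, x.2.1⟩, ⟨x.1.2, x.2.2⟩)
  invFun y := ⟨(y.1, y.2), y.1.2, y.2.2⟩
  map_add' _ _ := rfl
  map_smul' _ _ := rfl
  left_inv _ := rfl
  right_inv _ := rfl

instance finiteDimensional_pairDomain (p q : ℕ) : FiniteDimensional K (pairDomain p K q) :=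
  Module.Finite.equiv (pairDomainEquiv p K q).symm

theorem finrank_pairDomain {q : ℕ} (h1 : 1 ≤ q) (hqp : q < p) :
    Module.finrank K (pairDomain p K q) = (p - 1) * p := by
  rw [(pairDomainEquiv p K q).finrank_eq, Module.finrank_prod, finrank_biHom, finrank_biHom,
    ← add_mul]
  congr 1
  omega

end PairDomain

section CuspidalModel

variable {p : ℕ} [Fact p.Prime] {K : Type*} [Field K] [Algebra (ZMod p) K] {α : K} {β : ZMod p}

/-- The map sending a pair of polynomials to a function on `GL₂(𝔽_p)` in `ind_T^G ω₂^(q+i(p+1))`. -/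
noncomputable def pairMap (p : ℕ) [Fact p.Prime] [Algebra (ZMod p) K] (α : K) (q i : ℕ) :
    (MvPolynomial (Fin 2 × Fin 2) K × MvPolynomial (Fin 2 × Fin 2) K) →ₗ[K]
      (GL (Fin 2) (ZMod p) → K) :=
  LinearMap.pi fun g =>
    (algebraMap (ZMod p) K g.val.det ^ (i + 1) •
      (evalRows (rowCoord α g) (rowCoord (-α) g)).toLinearMap).coprod
    (algebraMap (ZMod p) K g.val.det ^ (i + q) •
      (evalRows (rowCoord (-α) g) (rowCoord α g)).toLinearMap)

theorem pairMap_apply (q i : ℕ) (H₁ H₂ : MvPolynomial (Fin 2 × Fin 2) K)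
    (g : GL (Fin 2) (ZMod p)) :
    pairMap p α q i (H₁, H₂) g =
      algebraMap (ZMod p) K g.val.det ^ (i + 1) * evalRows (rowCoord α g) (rowCoord (-α) g) H₁ +
      algebraMap (ZMod p) K g.val.det ^ (i + q) * evalRows (rowCoord (-α) g) (rowCoord α g) H₂ :=
  rfl

theorem pairMap_mem [Fintype K] (hq : QuadraticGenerator p α β) {q i s : ℕ} (h1 : 1 ≤ q)
    (hqi : q + i < p) (hs : s = q + i * (p + 1))
    {H : MvPolynomial (Fin 2 × Fin 2) K × MvPolynomial (Fin 2 × Fin 2) K}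
    (hH : H ∈ pairDomain p K q) : pairMap p α q i H ∈ inducedFunctions α β s := by
  obtain ⟨H₁, H₂⟩ := H
  obtain ⟨hH₁, hH₂⟩ := hH
  have hp := (Fact.out : p.Prime).two_le
  intro t ht g
  have e1 : rowCoord α (t * g) = rowCoord α t 0 • rowCoord α g :=
    funext fun j => rowCoord_mul hq ht g j
  have e2 : rowCoord (-α) (t * g) = rowCoord α t 0 ^ p • rowCoord (-α) g :=
    funext fun j => rowCoord_neg_mul hq ht g j
  have hx := rowCoord_ne_zero hq t
  rw [pairMap_apply, pairMap_apply, e1, e2, evalRows_smul hH₁, evalRows_smul hH₂, Units.val_mul,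
    Matrix.det_mul, map_mul, algebraMap_det_torus hq ht]
  set χ := rowCoord α t 0
  obtain ⟨n, rfl⟩ : ∃ n, p = n + 1 := ⟨p - 1, by omega⟩
  rw [mul_add]
  congr 1
  · rcases Nat.lt_or_ge q 2 with h | h
    · have : H₁ = 0 := by
        have : q - 1 = 0 := by omega
        rw [this, biHom_zero] at hH₁
        exact hH₁
      simp [this]
    · obtain ⟨k, rfl⟩ : ∃ k, q = k + 2 := ⟨q - 2, by omega⟩
      have : χ ^ ((n + 2) * (i + 1) + k + (n + 1) * n) = χ ^ s := by
        refine hq.pow_eq_pow hx ?_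
        rw [hs]
        ring
      rw [← this]
      simp only [Nat.add_sub_cancel, show k + 2 - 1 - 1 = k by omega]
      ring
  · obtain ⟨k, hk⟩ : ∃ k, n = q + k := ⟨n - q, by omega⟩
    have : χ ^ ((n + 2) * (i + q) + (n + 1) * k + n) = χ ^ s := by
      refine hq.pow_eq_pow hx ?_
      rw [hs, hk]
      ring
    rw [← this]
    simp only [Nat.add_sub_cancel, show n + 1 - q - 1 = k by omega]
    ring

/-- Restriction of functions to the mirabolic subgroup. -/
noncomputable def restrictMirabolic (p : ℕ) [Fact p.Prime] (K : Type*) [Field K] :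
    (GL (Fin 2) (ZMod p) → K) →ₗ[K] (ZMod p × (ZMod p)ˣ → K) :=
  LinearMap.funLeft K K mirabolic

theorem rowCoord_mirabolic (a : K) (x : ZMod p × (ZMod p)ˣ) :
    rowCoord a (mirabolic x) = ![1, algebraMap (ZMod p) K x.1 + algebraMap (ZMod p) K x.2 * a] := by
  funext j
  fin_cases j <;> simp [rowCoord, mirabolic_val]

theorem det_mirabolic (x : ZMod p × (ZMod p)ˣ) : (mirabolic x).val.det = x.2 := by
  simp [mirabolic_val, Matrix.det_fin_two]

theorem exists_pairMap_mirabolic [Fintype K] (hq : QuadraticGenerator p α β) {q i : ℕ} (h1 : 1 ≤ q)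
    (hqi : q < p) : (pairDomain p K q).map (restrictMirabolic p K ∘ₗ pairMap p α q i) = ⊤ := by
  set N := (pairDomain p K q).map (restrictMirabolic p K ∘ₗ pairMap p α q i) with hN
  have hp := (Fact.out : p.Prime).two_le
  have hK := charP_of_zmod_algebra p K
  have hA : CharP (ZMod p × (ZMod p)ˣ → K) p :=
    charP_of_injective_algebraMap (algebraMap K (ZMod p × (ZMod p)ˣ → K)).injective p
  set x : ZMod p × (ZMod p)ˣ → K := fun z =>
    algebraMap (ZMod p) K z.1 + algebraMap (ZMod p) K z.2 * α with hx
  set y : ZMod p × (ZMod p)ˣ → K := fun z =>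
    algebraMap (ZMod p) K z.1 + algebraMap (ZMod p) K z.2 * (-α) with hy
  set d : ZMod p × (ZMod p)ˣ → K := fun z => algebraMap (ZMod p) K z.2 with hd
  set e : ZMod p × (ZMod p)ˣ → K := (-2 * α) • d with he
  have hd0 (z) : d z ≠ 0 := by simp [hd]
  have hxp : x ^ p = y := by
    funext z
    rw [Pi.pow_apply, hx, add_pow_char, mul_pow, hq.pow_char, algebraMap_pow_char,
      algebraMap_pow_char]
  have hep : e ^ (p - 1) = -1 := by
    funext z
    have he0 : e z ≠ 0 := by
      simp only [he, Pi.smul_apply, smul_eq_mul]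
      exact mul_ne_zero (mul_ne_zero (neg_ne_zero.mpr hq.two_ne_zero) hq.ne_zero) (hd0 z)
    apply mul_left_cancel₀ he0
    rw [Pi.pow_apply, ← pow_succ', Nat.sub_add_cancel (by omega)]
    simp only [he, Pi.smul_apply, smul_eq_mul, hd, Pi.neg_apply, Pi.one_apply]
    have h2 : (-2 : K) ^ p = -2 := by
      have := algebraMap_pow_char (p := p) (K := K) (-2)
      rwa [map_neg, map_ofNat] at this
    rw [mul_pow, mul_pow, hq.pow_char, algebraMap_pow_char, h2]
    ring
  set W : Submodule K (ZMod p × (ZMod p)ˣ → K) := N.comap (LinearMap.mulLeft K (d ^ i)) with hW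
  have key : ∀ n, x ^ n ∈ W := by
    refine pow_mem_of_mul_mem (y := y) (e := e) ?_ hxp hep h1 hqi W ?_ ?_
    · funext z
      simp only [hx, hy, he, hd, Pi.add_apply, Pi.smul_apply, smul_eq_mul]
      ring
    · intro b j hb hj
      have hm : quadMonomial K (q - 2 - b) b (p - 1 - j) j ∈ biHom p K (q - 1) :=
        quadMonomial_mem_biHom (by omega) (by omega)
      have : (restrictMirabolic p K ∘ₗ pairMap p α q i)
          ((-2 * α) • (quadMonomial K (q - 2 - b) b (p - 1 - j) j, 0)) ∈ N :=
        Submodule.mem_map_of_mem (Submodule.smul_mem _ _ ⟨hm, zero_mem _⟩)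
      rw [hW, Submodule.mem_comap]
      convert this using 1
      rw [map_smul]
      funext z
      simp only [LinearMap.mulLeft_apply, LinearMap.comp_apply, Pi.smul_apply, Pi.mul_apply,
        Pi.pow_apply, restrictMirabolic, LinearMap.funLeft_apply, pairMap_apply,
        evalRows_quadMonomial, rowCoord_mirabolic, det_mirabolic, map_zero, hx, hy, hd, he,
        smul_eq_mul, Matrix.cons_val_zero, Matrix.cons_val_one, one_pow]
      ring
    · intro b j hb hj
      have hm : quadMonomial K (p - q - 1 - b) b (p - 1 - j) j ∈ biHom p K (p - q) :=
        quadMonomial_mem_biHom (by omega) (by omega)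
      have : (restrictMirabolic p K ∘ₗ pairMap p α q i)
          ((-2 * α) ^ q • (0, quadMonomial K (p - q - 1 - b) b (p - 1 - j) j)) ∈ N :=
        Submodule.mem_map_of_mem (Submodule.smul_mem _ _ ⟨zero_mem _, hm⟩)
      rw [hW, Submodule.mem_comap]
      convert this using 1
      rw [map_smul]
      funext z
      simp only [LinearMap.mulLeft_apply, LinearMap.comp_apply, Pi.smul_apply, Pi.mul_apply,
        Pi.pow_apply, restrictMirabolic, LinearMap.funLeft_apply, pairMap_apply,
        evalRows_quadMonomial, rowCoord_mirabolic, det_mirabolic, map_zero, hx, hy, hd, he,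
        smul_eq_mul, Matrix.cons_val_zero, Matrix.cons_val_one, one_pow, mul_pow]
      ring
  rw [eq_top_iff]
  intro f _
  have hinj : Function.Injective x := by
    rintro ⟨b, d⟩ ⟨b', d'⟩ h
    simp only [hx] at h
    obtain ⟨h2, h3⟩ := hq.eq_zero_of_add_mul_eq_zero (b := b - b') (d := (d : ZMod p) - d')
      (by rw [map_sub, map_sub]; linear_combination h)
    rw [sub_eq_zero] at h2 h3
    exact Prod.ext h2 (Units.ext h3)
  set P := Lagrange.interpolate Finset.univ x ((d ^ i)⁻¹ * f) with hP
  have hPx (z) : P.eval (x z) = ((d ^ i)⁻¹ * f) z :=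
    Lagrange.eval_interpolate_at_node _ hinj.injOn (Finset.mem_univ z)
  have hsum : ∑ n ∈ P.support, P.coeff n • x ^ n ∈ W :=
    W.sum_mem fun n _ => W.smul_mem _ (key n)
  rw [hW, Submodule.mem_comap] at hsum
  convert hsum using 1
  funext z
  have h3 := hPx z
  rw [Polynomial.eval_eq_sum, Polynomial.sum] at h3
  simp only [LinearMap.mulLeft_apply, Pi.mul_apply, Finset.sum_apply, Pi.smul_apply, Pi.pow_apply,
    smul_eq_mul]
  rw [h3, Pi.mul_apply, Pi.inv_apply, Pi.pow_apply, mul_inv_cancel_left₀ (pow_ne_zero _ (hd0 z))]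

/-- `pairMap` followed by restriction to the mirabolic subgroup, as a map on `pairDomain`. -/
noncomputable def pairMirabolic (p : ℕ) [Fact p.Prime] [Algebra (ZMod p) K] (α : K) (q i : ℕ) :
    pairDomain p K q →ₗ[K] (ZMod p × (ZMod p)ˣ → K) :=
  (restrictMirabolic p K ∘ₗ pairMap p α q i).domRestrict (pairDomain p K q)

theorem pairMirabolic_bijective [Fintype K] (hq : QuadraticGenerator p α β) {q i : ℕ} (h1 : 1 ≤ q)
    (hqp : q < p) : Function.Bijective (pairMirabolic p α q i) := by
  have hs : Function.Surjective (pairMirabolic p α q i) := by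
    intro f
    have hf : f ∈ (pairDomain p K q).map (restrictMirabolic p K ∘ₗ pairMap p α q i) := by
      rw [exists_pairMap_mirabolic hq h1 hqp]
      trivial
    obtain ⟨H, hH, rfl⟩ := hf
    exact ⟨⟨H, hH⟩, rfl⟩
  refine ⟨(LinearMap.injective_iff_surjective_of_finrank_eq_finrank ?_).mpr hs, hs⟩
  rw [finrank_pairDomain h1 hqp, Module.finrank_fintype_fun_eq_card, Fintype.card_prod,
    ZMod.card, ZMod.card_units p, mul_comm]

/-- `pairMap` as an isomorphism onto the space of functions underlying `ind_T^G ω₂^s`. -/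
noncomputable def pairEquiv [Fintype K] (hq : QuadraticGenerator p α β) {q i s : ℕ} (h1 : 1 ≤ q)
    (hqi : q + i < p) (hs : s = q + i * (p + 1)) :
    pairDomain p K q ≃ₗ[K] inducedFunctions α β s :=
  LinearEquiv.ofBijective
    (((pairMap p α q i).domRestrict (pairDomain p K q)).codRestrict (inducedFunctions α β s)
      fun H => pairMap_mem hq h1 hqi hs H.2) <| by
    have hb := pairMirabolic_bijective (i := i) hq h1 (by omega : q < p)
    constructor
    · intro H H' h
      apply hb.1
      exact congr_arg (fun f => restrictMirabolic p K f.1) h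
    · intro f
      obtain ⟨H, hH⟩ := hb.2 (restrictMirabolic p K f.1)
      refine ⟨H, Subtype.ext ?_⟩
      exact inducedFunctions_ext hq (pairMap_mem hq h1 hqi hs H.2) f.2 (congr_fun hH)

theorem pairEquiv_apply [Fintype K] (hq : QuadraticGenerator p α β) {q i s : ℕ} (h1 : 1 ≤ q)
    (hqi : q + i < p) (hs : s = q + i * (p + 1)) (H : pairDomain p K q) :
    (pairEquiv hq h1 hqi hs H : GL (Fin 2) (ZMod p) → K) = pairMap p α q i H := rfl

theorem finrank_inducedFunctions [Fintype K] (hq : QuadraticGenerator p α β) {q i s : ℕ}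
    (h1 : 1 ≤ q) (hqi : q + i < p) (hs : s = q + i * (p + 1)) :
    Module.finrank K (inducedFunctions α β s) = (p - 1) * p := by
  rw [← (pairEquiv hq h1 hqi hs).finrank_eq, finrank_pairDomain h1 (by omega)]

theorem pairMap_right_translate (q i : ℕ) (H₁ H₂ : MvPolynomial (Fin 2 × Fin 2) K)
    (x g : GL (Fin 2) (ZMod p)) :
    pairMap p α q i (H₁, H₂) (x * g) =
      pairMap p α q i (algebraMap (ZMod p) K g.val.det ^ (i + 1) • actK p K g.val H₁,
        algebraMap (ZMod p) K g.val.det ^ (i + q) • actK p K g.val H₂) x := by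
  rw [pairMap_apply, pairMap_apply, map_smul, map_smul, smul_eq_mul, smul_eq_mul, ← mul_assoc,
    ← mul_assoc, ← mul_pow, ← mul_pow, ← map_mul, Units.val_mul, Matrix.det_mul]
  simp only [← evalRows_actK, Units.val_mul, actK_mul_apply]

end CuspidalModel

section CuspidalStep

/-- The map `(S, H) ↦ D S + θ^(i+1) H`. -/
noncomputable def subMap (p : ℕ) (K : Type*) [Field K] (q i s : ℕ) :
    (biHom p K (s + 1) × biHom p K (q - 1)) →ₗ[K] MvPolynomial (Fin 2 × Fin 2) K :=
  (DK p K ∘ₗ (biHom p K (s + 1)).subtype).coprod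
    (LinearMap.mulLeft K (dickson p K ^ (i + 1)) ∘ₗ (biHom p K (q - 1)).subtype)

theorem subMap_apply {p : ℕ} {K : Type*} [Field K] (q i s : ℕ)
    (x : biHom p K (s + 1) × biHom p K (q - 1)) :
    subMap p K q i s x = DK p K x.1 + dickson p K ^ (i + 1) * x.2 := rfl

variable {p : ℕ} [Fact p.Prime] {K : Type*} [Field K] [Algebra (ZMod p) K]
  {α : K} {β : ZMod p}

theorem subMap_injective {q i s : ℕ} (h1 : 1 ≤ q) (hqi : q + i < p) (hs : s = q + i * (p + 1)) :
    Function.Injective (subMap p K q i s) := by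
  have := charP_of_zmod_algebra p K
  rw [injective_iff_map_eq_zero]
  rintro ⟨⟨S, hS⟩, ⟨H, hH⟩⟩ h
  rw [subMap_apply] at h
  have hS0 : S = 0 := eq_zero_of_DK_eq_dickson_pow_mul h1 hqi hs hS (H := -H)
    (by linear_combination h)
  subst hS0
  rw [map_zero, zero_add, mul_eq_zero] at h
  have hH0 : H = 0 := h.resolve_left (pow_ne_zero _ dickson_ne_zero)
  subst hH0
  rfl

theorem actK_dickson_pow_mul (g : GL (Fin 2) (ZMod p)) (i : ℕ)
    (H : MvPolynomial (Fin 2 × Fin 2) K) :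
    actK p K g.val (dickson p K ^ i * H) =
      dickson p K ^ i * (algebraMap (ZMod p) K g.val.det ^ i • actK p K g.val H) := by
  rw [actK_map_mul, actK_map_pow, actK_dickson, mul_pow, ← C_pow, smul_eq_C_mul]
  ring

/-- The functional detecting the subrepresentation `θ^(i+1) V_(q-2)` modulo the image of `D`. -/
theorem exists_functional_dickson_pow [Fintype K] (hq : QuadraticGenerator p α β)
    {q i s : ℕ} (h1 : 1 ≤ q)
    (hqi : q + i < p) (hs : s = q + i * (p + 1)) :
    ∃ φ : MvPolynomial (Fin 2 × Fin 2) K →ₗ[K] K, IsCovariantOn α β s ⊤ φ ∧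
      (∀ S ∈ biHom p K (s + 1), φ (DK p K S) = 0) ∧
      ∀ H ∈ biHom p K (q - 1), φ (dickson p K ^ (i + 1) * H) =
        evalRows ![1, α] ![1, -α] H := by
  have hp := (Fact.out : p.Prime).pos
  obtain ⟨L, hL⟩ := LinearMap.exists_leftInverse_of_injective _
    (LinearMap.ker_eq_bot.mpr (subMap_injective (K := K) h1 hqi hs))
  set φ := (evalRows ![1, α] ![1, -α]).toLinearMap ∘ₗ (biHom p K (q - 1)).subtype ∘ₗ
    LinearMap.snd K _ _ ∘ₗ L with hφ
  have hφL (x) : φ (subMap p K q i s x) = evalRows ![1, α] ![1, -α] x.2 := by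
    rw [hφ]
    simp only [LinearMap.comp_apply]
    rw [← LinearMap.comp_apply L, hL]
    rfl
  have hcov : IsCovariantOn α β s (LinearMap.range (subMap p K q i s)) φ := by
    rintro t ht _ ⟨⟨⟨S, hS⟩, ⟨H, hH⟩⟩, rfl⟩
    have e : actK p K t.val (subMap p K q i s (⟨S, hS⟩, ⟨H, hH⟩)) =
        subMap p K q i s (⟨actK p K t.val S, actK_mem_biHom hp _ hS⟩,
          ⟨algebraMap (ZMod p) K t.val.det ^ (i + 1) • actK p K t.val H,
            Submodule.smul_mem _ _ (actK_mem_biHom hp _ hH)⟩) := by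
      rw [subMap_apply, subMap_apply, map_add, actK_dickson_pow_mul, DK_actK]
    have hpair : pairMap p α q i (H, 0) ∈ inducedFunctions α β s :=
      pairMap_mem hq h1 hqi hs ⟨hH, zero_mem _⟩
    have h2 := hpair t ht 1
    rw [mul_one, pairMap_apply, pairMap_apply, map_zero, map_zero, mul_zero, add_zero, mul_zero,
      add_zero, rowCoord_one, rowCoord_one, Units.val_one, Matrix.det_one, map_one, one_pow,
      one_mul, ← evalRows_actK] at h2
    rw [e, hφL, hφL, map_smul, smul_eq_mul]
    exact h2
  obtain ⟨φ', hφ', hag⟩ := exists_isCovariantOn_top hq hcov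
  refine ⟨φ', hφ', fun S hS => ?_, fun H hH => ?_⟩
  · have h2 : DK p K S = subMap p K q i s (⟨S, hS⟩, 0) := by simp [subMap_apply]
    rw [h2, hag _ ⟨_, rfl⟩, hφL]
    simp
  · have h2 : dickson p K ^ (i + 1) * H = subMap p K q i s (0, ⟨H, hH⟩) := by
      simp [subMap_apply]
    rw [h2, hag _ ⟨_, rfl⟩, hφL]

/-- The functional `R ↦ (D^(p-1) R)(1, α, 1, α)`. -/
noncomputable def topFunctional (p : ℕ) (α : K) : MvPolynomial (Fin 2 × Fin 2) K →ₗ[K] K :=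
  (evalRows ![1, α] ![1, α]).toLinearMap ∘ₗ DK p K ^ (p - 1)

theorem topFunctional_actK (g : GL (Fin 2) (ZMod p)) (R : MvPolynomial (Fin 2 × Fin 2) K) :
    topFunctional p α (actK p K g.val R) =
      evalRows (rowCoord α g) (rowCoord α g) ((DK p K ^ (p - 1)) R) := by
  rw [topFunctional, LinearMap.comp_apply, DK_pow_actK, AlgHom.toLinearMap_apply, evalRows_actK]

theorem isCovariantOn_topFunctional [Fintype K] (hq : QuadraticGenerator p α β) (s : ℕ) :
    IsCovariantOn α β s (biHom p K (s + p)) (topFunctional p α) := by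
  intro t ht R hR
  have hp := (Fact.out : p.Prime).two_le
  have hm := DK_pow_mem_biHom (by omega) (p - 1) hR
  rw [topFunctional_actK, rowCoord_torus hq ht, evalRows_smul hm, ← pow_add, topFunctional,
    LinearMap.comp_apply, AlgHom.toLinearMap_apply, ← rowCoord_torus hq ht]
  congr 1
  refine hq.pow_eq_pow (rowCoord_ne_zero hq t) ?_
  obtain ⟨n, rfl⟩ : ∃ n, p = n + 1 := ⟨p - 1, by omega⟩
  simp only [Nat.add_sub_cancel]
  have h : s + (n + 1) + n * n - 1 = s + n + n * n := by omega
  rw [h]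
  ring

theorem topFunctional_DK {k : ℕ} {S : MvPolynomial (Fin 2 × Fin 2) K} (hS : S ∈ biHom p K k) :
    topFunctional p α (DK p K S) = 0 := by
  have := charP_of_zmod_algebra p K
  have hp := (Fact.out : p.Prime).pos
  rw [topFunctional, LinearMap.comp_apply, ← Module.End.mul_apply, ← pow_succ,
    Nat.sub_add_cancel hp, DK_pow_char_apply hS, map_zero]

theorem topFunctional_dickson_pow_mul {k : ℕ} (hk : k < p) (i : ℕ)
    {H : MvPolynomial (Fin 2 × Fin 2) K} (hH : H ∈ biHom p K k) :
    topFunctional p α (dickson p K ^ i * H) = 0 := by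
  have := charP_of_zmod_algebra p K
  rw [topFunctional, LinearMap.comp_apply, DK_pow_mul_of_eq_zero (DK_pow_const DK_dickson i),
    DK_pow_eq_zero_of_lt (by omega) hH, mul_zero, map_zero]

theorem evalRows_dickson_rowCoord (g : GL (Fin 2) (ZMod p)) :
    evalRows (rowCoord α g) (rowCoord α g) (dickson p K) =
      algebraMap (ZMod p) K g.val.det * (α - α ^ p) := by
  rw [← evalRows_actK, actK_dickson, map_mul, evalRows_dickson]
  simp [evalRows]

theorem exists_orbitMap_topFunctional [Fintype K] (hq : QuadraticGenerator p α β)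
    {q i s : ℕ} (h1 : 1 ≤ q)
    (hqi : q + i < p) (hs : s = q + i * (p + 1)) {H : MvPolynomial (Fin 2 × Fin 2) K}
    (hH : H ∈ biHom p K (p - q)) :
    ∃ R ∈ biHom p K (s + p), orbitMap p (topFunctional p α) R = pairMap p α q i (0, H) := by
  have hK := charP_of_zmod_algebra p K
  have hp := (Fact.out : p.Prime)
  suffices h : biHom p K (p - q) ≤ ((biHom p K (s + p)).map
      (orbitMap p (topFunctional p α))).comap (pairMap p α q i ∘ₗ LinearMap.inr K _ _) from h hH
  refine biHom_le fun a b c d hab hcd => ?_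
  set κ : K := (p - 1).factorial * (p - 1 - a).choose b with hκ
  have hκ0 : κ ≠ 0 := by
    rw [hκ]
    refine mul_ne_zero ?_ ?_
    · rw [Ne, CharP.cast_eq_zero_iff K p, hp.dvd_factorial]
      have := hp.pos
      omega
    · rw [Ne, CharP.cast_eq_zero_iff K p]
      intro h
      have h2 := (h.mul_right b.factorial).mul_right (p - 1 - a - b).factorial
      rw [Nat.choose_mul_factorial_mul_factorial (by omega), hp.dvd_factorial] at h2
      have := hp.pos
      omega
  have hδ : α - α ^ p ≠ 0 := by
    rw [hq.pow_char, sub_neg_eq_add, ← two_mul]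
    exact mul_ne_zero hq.two_ne_zero hq.ne_zero
  rw [Submodule.mem_comap]
  have hmem : dickson p K ^ i * quadMonomial K (p - 1 - b) (p - 1 - a) c d ∈
      biHom p K (s + p) := by
    have h2 : quadMonomial K (p - 1 - b) (p - 1 - a) c d ∈ biHom p K (p + q) :=
      quadMonomial_mem_biHom (by omega) hcd
    have h3 := mul_mem_biHom (isBiHom_pow (isBiHom_dickson (K := K) p) i) h2
    convert h3 using 2
    rw [hs]
    ring
  refine ⟨(κ * (α - α ^ p) ^ (i + q))⁻¹ • (dickson p K ^ i *
    quadMonomial K (p - 1 - b) (p - 1 - a) c d), Submodule.smul_mem _ _ hmem, ?_⟩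
  rw [map_smul, inv_smul_eq_iff₀ (mul_ne_zero hκ0 (pow_ne_zero _ hδ))]
  funext g
  rw [orbitMap_apply, topFunctional_actK, DK_pow_mul_of_eq_zero (DK_pow_const DK_dickson i),
    DK_pow_pred_quadMonomial h1 (by omega), map_mul, map_smul, map_mul, map_pow, map_pow,
    evalRows_dickson_rowCoord, evalRows_quadMonomial, Pi.smul_apply, LinearMap.comp_apply,
    LinearMap.inr_apply, pairMap_apply, evalRows_quadMonomial, map_zero, smul_eq_mul, smul_eq_mul,
    rowCoord_neg hq, rowCoord_neg hq, pow_mul, pow_mul, hκ,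
    mul_pow _ (α - α ^ p), mul_pow _ (α - α ^ p)]
  ring

end CuspidalStep

section CuspidalQuotient

variable {p : ℕ} [Fact p.Prime] {K : Type*} [Field K] [Algebra (ZMod p) K]
  {α : K} {β : ZMod p}

theorem actK_one (R : MvPolynomial (Fin 2 × Fin 2) K) : actK p K 1 R = R := by
  suffices h : actK p K 1 = LinearMap.id by rw [h, LinearMap.id_apply]
  rw [← AlgHom.toLinearMap_id, actK]
  congr 1
  apply MvPolynomial.algHom_ext
  rintro ⟨i, j⟩
  fin_cases j <;> simp

/-- A functional all of whose orbit map is in `ind_T^G ω₂^s`, followed by the projection of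
`ind_T^G ω₂^s` on the first component of `pairMap`. -/
theorem exists_first_component [Fintype K] (hq : QuadraticGenerator p α β) {q i s : ℕ}
    (h1 : 1 ≤ q) (hqi : q + i < p) (hs : s = q + i * (p + 1))
    {φ : MvPolynomial (Fin 2 × Fin 2) K →ₗ[K] K} (hφ : IsCovariantOn α β s ⊤ φ) :
    ∃ F : Module.End K (MvPolynomial (Fin 2 × Fin 2) K),
      (∀ R, F R ∈ biHom p K (q - 1)) ∧
      (∀ (g : GL (Fin 2) (ZMod p)) R, F (actK p K g.val R) =
        algebraMap (ZMod p) K g.val.det ^ (i + 1) • actK p K g.val (F R)) ∧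
      ∀ R, ∀ H ∈ biHom p K (q - 1), orbitMap p φ R = pairMap p α q i (H, 0) → F R = H := by
  have hp := (Fact.out : p.Prime).pos
  set E := pairEquiv hq h1 hqi hs with hE
  set O := (orbitMap p φ).codRestrict (inducedFunctions α β s)
    fun R => orbitMap_mem hφ fun _ => Submodule.mem_top with hO
  have key (R) (H : pairDomain p K q) (h : orbitMap p φ R = pairMap p α q i H) :
      E.symm (O R) = H := by
    rw [LinearEquiv.symm_apply_eq]
    exact Subtype.ext h
  refine ⟨LinearMap.fst K _ _ ∘ₗ (pairDomain p K q).subtype ∘ₗ E.symm.toLinearMap ∘ₗ O,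
    fun R => (E.symm (O R)).2.1, fun g R => ?_, fun R H hH h => ?_⟩
  · have h2 : orbitMap p φ R = pairMap p α q i (E.symm (O R)) := by
      rw [← pairEquiv_apply hq h1 hqi hs, ← hE, LinearEquiv.apply_symm_apply]
      rfl
    obtain ⟨⟨⟨A, B⟩, hA, hB⟩, hAB⟩ : ∃ x, E.symm (O R) = x := ⟨_, rfl⟩
    rw [hAB] at h2
    have h3 := key (actK p K g.val R) ⟨(_, _),
      Submodule.smul_mem _ (algebraMap (ZMod p) K g.val.det ^ (i + 1)) (actK_mem_biHom hp g.val hA),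
      Submodule.smul_mem _ (algebraMap (ZMod p) K g.val.det ^ (i + q))
        (actK_mem_biHom hp g.val hB)⟩ (by
        funext x
        rw [← pairMap_right_translate, ← h2, orbitMap_apply, orbitMap_apply, Units.val_mul,
          actK_mul_apply])
    simp only [LinearMap.comp_apply, LinearEquiv.coe_coe, h3, hAB]
    rfl
  · have h3 := key R ⟨(H, 0), hH, zero_mem _⟩ h
    simp only [LinearMap.comp_apply, LinearEquiv.coe_coe, h3]
    rfl

theorem DK_injOn {q i s : ℕ} (h1 : 1 ≤ q) (hqi : q + i < p) (hs : s = q + i * (p + 1)) :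
    Function.Injective (DK p K ∘ₗ (biHom p K (s + 1)).subtype) := by
  have := charP_of_zmod_algebra p K
  rw [injective_iff_map_eq_zero]
  rintro ⟨S, hS⟩ h
  exact Subtype.ext (eq_zero_of_DK_eq_dickson_pow_mul h1 hqi hs hS (H := 0) (by simpa using h))

/-- The quotient of `V_{s+p-1} ⊗ V_{p-1}` by the image of `D` is `ind_T^G ω₂^s`. -/
theorem exists_functional_of_quotient [Fintype K] (hq : QuadraticGenerator p α β) {q i s : ℕ}
    (h1 : 1 ≤ q) (hqi : q + i < p) (hs : s = q + i * (p + 1)) :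
    ∃ φ : MvPolynomial (Fin 2 × Fin 2) K →ₗ[K] K, IsCovariantOn α β s ⊤ φ ∧
      (∀ R ∈ biHom p K (s + p), orbitMap p φ R = 0 ↔ ∃ S ∈ biHom p K (s + 1), DK p K S = R) ∧
      ∀ h ∈ inducedFunctions α β s, ∃ R ∈ biHom p K (s + p), orbitMap p φ R = h := by
  have hp := (Fact.out : p.Prime).pos
  obtain ⟨φ₁, hφ₁, hD, hH⟩ := exists_functional_dickson_pow hq h1 hqi hs
  obtain ⟨F, hF, hFg, hF0⟩ := exists_first_component hq h1 hqi hs hφ₁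
  have hFD (S) (hS : S ∈ biHom p K (s + 1)) : F (DK p K S) = 0 := by
    refine hF0 _ 0 (zero_mem _) ?_
    funext g
    rw [orbitMap_apply, ← DK_actK, hD _ (actK_mem_biHom hp _ hS)]
    simp [pairMap_apply]
  have hFH (H) (hHm : H ∈ biHom p K (q - 1)) : F (dickson p K ^ (i + 1) * H) = H := by
    refine hF0 _ H hHm ?_
    funext g
    rw [orbitMap_apply, actK_dickson_pow_mul,
      hH _ (Submodule.smul_mem _ _ (actK_mem_biHom hp _ hHm)), map_smul, evalRows_actK,
      pairMap_apply, map_zero, mul_zero, add_zero, smul_eq_mul]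
  set φ := (evalRows ![1, α] ![1, -α]).toLinearMap ∘ₗ F + topFunctional p α with hφ
  have horb (R) : orbitMap p φ R =
      pairMap p α q i (F R, 0) + orbitMap p (topFunctional p α) R := by
    funext g
    rw [orbitMap_apply, hφ, LinearMap.add_apply, LinearMap.comp_apply, hFg, map_smul,
      AlgHom.toLinearMap_apply, evalRows_actK, Pi.add_apply, pairMap_apply, map_zero, mul_zero,
      add_zero, smul_eq_mul, orbitMap_apply]
  have hcov : IsCovariantOn α β s (biHom p K (s + p)) φ := by
    intro t ht R hR
    have h2 := pairMap_mem hq h1 hqi hs (H := (F R, 0)) ⟨hF R, zero_mem _⟩ t ht 1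
    have h3 := isCovariantOn_topFunctional hq s t ht R hR
    have h4 := congr_fun (horb R) t
    have h5 := congr_fun (horb R) 1
    rw [orbitMap_apply, Pi.add_apply, orbitMap_apply] at h4 h5
    rw [Units.val_one, actK_one] at h5
    rw [mul_one] at h2
    rw [h4, h5, h2, h3, mul_add]
  obtain ⟨φ', hφ', hag⟩ := exists_isCovariantOn_top hq hcov
  have horb' (R) (hR : R ∈ biHom p K (s + p)) : orbitMap p φ' R =
      pairMap p α q i (F R, 0) + orbitMap p (topFunctional p α) R := by
    rw [← horb]
    funext g
    exact hag _ (actK_mem_biHom hp _ hR)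
  have hDm (S) (hS : S ∈ biHom p K (s + 1)) : DK p K S ∈ biHom p K (s + p) := by
    have := DK_mem_biHom hS
    rwa [show s + 1 + p - 1 = s + p by omega] at this
  have hker (S) (hS : S ∈ biHom p K (s + 1)) : orbitMap p φ' (DK p K S) = 0 := by
    rw [horb' _ (hDm S hS), hFD S hS]
    funext g
    rw [Pi.add_apply, orbitMap_apply, ← DK_actK, topFunctional_DK (actK_mem_biHom hp _ hS)]
    simp [pairMap_apply]
  have hsurj : ∀ h ∈ inducedFunctions α β s, ∃ R ∈ biHom p K (s + p), orbitMap p φ' R = h := by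
    intro h hh
    obtain ⟨⟨⟨H₁, H₂⟩, hH₁, hH₂⟩, hHh⟩ := (pairEquiv hq h1 hqi hs).surjective ⟨h, hh⟩
    replace hHh : pairMap p α q i (H₁, H₂) = h := congr_arg Subtype.val hHh
    obtain ⟨R₂, hR₂, hR₂'⟩ := exists_orbitMap_topFunctional hq h1 hqi hs hH₂
    have hm : H₁ - F R₂ ∈ biHom p K (q - 1) := sub_mem hH₁ (hF R₂)
    have hm' : dickson p K ^ (i + 1) * (H₁ - F R₂) ∈ biHom p K (s + p) := by
      have h3 := mul_mem_biHom (isBiHom_pow (isBiHom_dickson (K := K) p) (i + 1)) hm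
      have h4 : q - 1 + (i + 1) * (p + 1) = s + p := by
        rw [hs, add_one_mul]
        omega
      rwa [h4] at h3
    refine ⟨R₂ + dickson p K ^ (i + 1) * (H₁ - F R₂), add_mem hR₂ hm', ?_⟩
    have h3 : orbitMap p (topFunctional p α) (dickson p K ^ (i + 1) * (H₁ - F R₂)) = 0 := by
      funext g
      rw [orbitMap_apply, actK_dickson_pow_mul]
      exact topFunctional_dickson_pow_mul (by omega) _
        (Submodule.smul_mem _ _ (actK_mem_biHom hp _ hm))
    rw [map_add, horb' _ hR₂, horb' _ hm', hFH _ hm, hR₂', h3, ← hHh, add_zero, add_right_comm,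
      ← map_add, ← map_add]
    simp
  refine ⟨φ', hφ', fun R hR => ⟨fun h0 => ?_, ?_⟩, hsurj⟩
  · set f := (orbitMap p φ').domRestrict (biHom p K (s + p)) with hf
    have hrange : LinearMap.range f = inducedFunctions α β s := by
      ext h
      constructor
      · rintro ⟨R, rfl⟩
        exact orbitMap_mem hφ' fun _ => Submodule.mem_top
      · intro hh
        obtain ⟨R, hR, rfl⟩ := hsurj h hh
        exact ⟨⟨R, hR⟩, rfl⟩
    set d := (DK p K ∘ₗ (biHom p K (s + 1)).subtype).codRestrict (biHom p K (s + p))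
      fun S => hDm S S.2 with hd
    have hle : LinearMap.range d ≤ LinearMap.ker f := by
      rintro _ ⟨S, rfl⟩
      exact hker S S.2
    have hdim := f.finrank_range_add_finrank_ker
    have hinj : Function.Injective d := fun S S' h =>
      DK_injOn h1 hqi hs (congr_arg Subtype.val h)
    rw [hrange, finrank_inducedFunctions hq h1 hqi hs, finrank_biHom] at hdim
    have heq := Submodule.eq_of_le_of_finrank_eq hle (by
      rw [LinearMap.finrank_range_of_inj hinj, finrank_biHom]
      have : (p - 1) * p + (s + 1) * p = (s + p) * p := by
        rw [← add_mul]
        congr 1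
        omega
      omega)
    have hmem : (⟨R, hR⟩ : biHom p K (s + p)) ∈ LinearMap.ker f := h0
    rw [← heq] at hmem
    obtain ⟨S, hS⟩ := hmem
    exact ⟨S, S.2, congr_arg Subtype.val hS⟩
  · rintro ⟨S, hS, rfl⟩
    exact hker S hS

end CuspidalQuotient

section IteratedQuotient

variable {p : ℕ} [Fact p.Prime] {K : Type*} [Field K] [Algebra (ZMod p) K] [Fintype K]
  {α : K} {β : ZMod p}

/-- Functionals can be transported along `D`. -/
theorem exists_functional_comp_DK (hq : QuadraticGenerator p α β) {q i s : ℕ}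
    (h1 : 1 ≤ q) (hqi : q + i < p) (hs : s = q + i * (p + 1)) {e : ℕ}
    {φ : MvPolynomial (Fin 2 × Fin 2) K →ₗ[K] K} (hφ : IsCovariantOn α β e ⊤ φ) :
    ∃ φ' : MvPolynomial (Fin 2 × Fin 2) K →ₗ[K] K, IsCovariantOn α β e ⊤ φ' ∧
      ∀ S ∈ biHom p K (s + 1), orbitMap p φ' (DK p K S) = orbitMap p φ S := by
  have hp := (Fact.out : p.Prime).pos
  obtain ⟨L, hL⟩ := LinearMap.exists_leftInverse_of_injective _
    (LinearMap.ker_eq_bot.mpr (DK_injOn (K := K) h1 hqi hs))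
  have hLS (S) (hS : S ∈ biHom p K (s + 1)) : L (DK p K S) = ⟨S, hS⟩ :=
    LinearMap.congr_fun hL ⟨S, hS⟩
  have hcov : IsCovariantOn α β e ((biHom p K (s + 1)).map (DK p K))
      (φ ∘ₗ (biHom p K (s + 1)).subtype ∘ₗ L) := by
    rintro t ht _ ⟨S, hS, rfl⟩
    simp only [LinearMap.comp_apply, ← DK_actK, hLS _ hS, hLS _ (actK_mem_biHom hp t.val hS)]
    exact hφ t ht S Submodule.mem_top
  obtain ⟨φ', hφ', hag⟩ := exists_isCovariantOn_top hq hcov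
  refine ⟨φ', hφ', fun S hS => ?_⟩
  funext g
  have hgS := actK_mem_biHom hp g.val hS
  rw [orbitMap_apply, orbitMap_apply, ← DK_actK, hag _ ⟨_, hgS, rfl⟩]
  simp only [LinearMap.comp_apply, hLS _ hgS, Submodule.subtype_apply]

/-- The successive quotients by the iterates of `D` split as a direct sum of the representations
`ind_T^G ω₂^(ρ+j(p-1))`. -/
theorem exists_functionals_of_iterated_quotient (hq : QuadraticGenerator p α β) {m ρ : ℕ}
    (hm : 2 * m + 1 ≤ ρ) (hρ : ρ < p) {k : ℕ} (hk : k ≤ m + 1) :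
    ∃ φ : ℕ → MvPolynomial (Fin 2 × Fin 2) K →ₗ[K] K,
      (∀ j < k, IsCovariantOn α β (ρ + j * (p - 1)) ⊤ (φ j)) ∧
      (∀ R ∈ biHom p K (ρ + k * (p - 1) + 1),
        (∀ j < k, orbitMap p (φ j) R = 0) ↔ ∃ S ∈ biHom p K (ρ + 1), (DK p K ^ k) S = R) ∧
      ∀ h : ℕ → GL (Fin 2) (ZMod p) → K,
        (∀ j < k, h j ∈ inducedFunctions α β (ρ + j * (p - 1))) →
        ∃ R ∈ biHom p K (ρ + k * (p - 1) + 1), ∀ j < k, orbitMap p (φ j) R = h j := by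
  have hp := (Fact.out : p.Prime).pos
  induction k with
  | zero =>
    refine ⟨0, by simp, fun R hR => ⟨fun _ => ⟨R, by simpa using hR, rfl⟩, by simp⟩,
      fun h _ => ⟨0, zero_mem _, by simp⟩⟩
  | succ k ih =>
    obtain ⟨φ, hφ, hker, hsurj⟩ := ih (by omega)
    set s := ρ + k * (p - 1) with hs'
    have hs : s = (ρ - 2 * k) + k * (p + 1) := by
      obtain ⟨n, rfl⟩ : ∃ n, p = n + 1 := ⟨p - 1, by omega⟩
      obtain ⟨l, rfl⟩ : ∃ l, ρ = l + 2 * k := ⟨ρ - 2 * k, by omega⟩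
      rw [hs', Nat.add_sub_cancel, Nat.add_sub_cancel]
      ring
    have hsp : ρ + (k + 1) * (p - 1) + 1 = s + p := by
      rw [hs', add_one_mul]
      omega
    have h1 : 1 ≤ ρ - 2 * k := by omega
    have hqi : ρ - 2 * k + k < p := by omega
    choose! φ' hφ' hDφ using fun j (hj : j < k) =>
      exists_functional_comp_DK hq h1 hqi hs (hφ j hj)
    obtain ⟨χ, hχ, hχker, hχsurj⟩ := exists_functional_of_quotient hq h1 hqi hs
    have hDm (S) (hS : S ∈ biHom p K (s + 1)) : DK p K S ∈ biHom p K (s + p) := by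
      have := DK_mem_biHom hS
      rwa [show s + 1 + p - 1 = s + p by omega] at this
    rw [hsp]
    refine ⟨fun j => if j < k then φ' j else χ, fun j hj => ?_, fun R hR => ?_, fun h hh => ?_⟩
    · dsimp only
      split_ifs with hjk
      · exact hφ' j hjk
      · obtain rfl : j = k := by omega
        exact hχ
    · simp only [Nat.forall_lt_succ_right, lt_irrefl, if_false]
      rw [hχker R hR]
      constructor
      · rintro ⟨h0, S, hS, rfl⟩
        obtain ⟨S', hS', rfl⟩ := (hker S hS).mp fun j hj => by
          rw [← hDφ j hj S hS, ← h0 j hj, if_pos hj]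
        exact ⟨S', hS', by rw [pow_succ', Module.End.mul_apply]⟩
      · rintro ⟨S', hS', rfl⟩
        rw [pow_succ', Module.End.mul_apply]
        have hS : (DK p K ^ k) S' ∈ biHom p K (s + 1) := by
          have := DK_pow_mem_biHom hp k hS'
          rwa [add_right_comm] at this
        refine ⟨fun j hj => ?_, _, hS, rfl⟩
        rw [if_pos hj, hDφ j hj _ hS]
        exact (hker _ hS).mpr ⟨S', hS', rfl⟩ j hj
    · obtain ⟨R₀, hR₀, hR₀'⟩ := hχsurj (h k) (hh k (by omega))
      obtain ⟨S, hS, hS'⟩ := hsurj (fun j => h j - orbitMap p (φ' j) R₀) fun j hj =>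
        sub_mem (hh j (by omega)) (orbitMap_mem (hφ' j hj) fun _ => Submodule.mem_top)
      refine ⟨R₀ + DK p K S, add_mem hR₀ (hDm S hS), ?_⟩
      simp only [Nat.forall_lt_succ_right, lt_irrefl, if_false]
      constructor
      · intro j hj
        rw [if_pos hj, map_add, hDφ j hj S hS, hS' j hj, add_sub_cancel]
      · rw [map_add, hR₀', (hχker _ (hDm S hS)).mpr ⟨S, hS, rfl⟩, add_zero]

end IteratedQuotient

section TorusEigenbasis

variable {p : ℕ} [Fact p.Prime] {K : Type*} [Field K]

theorem actK2_torus_X_add [Algebra (ZMod p) K] {β : ZMod p} {t : GL (Fin 2) (ZMod p)}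
    (ht : t ∈ anisotropicTorus p β) {a : K} (ha : a ^ 2 = algebraMap (ZMod p) K β) :
    actK2 p K t.val (X 1 + C a * X 0) = C (rowCoord a t 0) * (X 1 + C a * X 0) := by
  rw [mem_anisotropicTorus] at ht
  have h1 : t.val 0 1 = t.val 1 0 * β := by rw [ht]; simp
  have h2 : t.val 1 1 = t.val 0 0 := by rw [ht]; simp
  simp only [actK2, AlgHom.toLinearMap_apply, map_add, map_mul, aeval_X, h1, h2, ← ha, rowCoord,
    map_pow, aeval_C, algebraMap_eq]
  ring

/-- The linear change of variables `X ↦ Y + a X`, `Y ↦ Y - a X`. -/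
noncomputable def eigenSubst (a : K) : MvPolynomial (Fin 2) K →ₐ[K] MvPolynomial (Fin 2) K :=
  aeval ![X 1 + C a * X 0, X 1 + C (-a) * X 0]

/-- The inverse of `eigenSubst`. -/
noncomputable def eigenSubstInv (a : K) : MvPolynomial (Fin 2) K →ₐ[K] MvPolynomial (Fin 2) K :=
  aeval ![C (2 * a)⁻¹ * (X 0 - X 1), C 2⁻¹ * (X 0 + X 1)]

theorem eigenSubstInv_eigenSubst {a : K} (ha : a ≠ 0) (h2 : (2 : K) ≠ 0)
    (P : MvPolynomial (Fin 2) K) : eigenSubstInv a (eigenSubst a P) = P := by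
  rw [← AlgHom.comp_apply]
  conv_rhs => rw [← AlgHom.id_apply (R := K) P]
  congr 1
  apply MvPolynomial.algHom_ext
  have h3 : C a * C (2 * a)⁻¹ = (C 2⁻¹ : MvPolynomial (Fin 2) K) := by
    rw [← C_mul]
    congr 1
    field_simp
  have h4 : (C 2⁻¹ : MvPolynomial (Fin 2) K) + C 2⁻¹ = 1 := by
    rw [← C_add, ← two_mul, mul_inv_cancel₀ h2, C_1]
  rw [Fin.forall_fin_two]
  simp only [AlgHom.comp_apply, AlgHom.id_apply, eigenSubst, eigenSubstInv, aeval_X, map_add,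
    map_neg, map_mul, aeval_C, algebraMap_eq, Matrix.cons_val_zero, Matrix.cons_val_one]
  constructor
  · linear_combination (X 0 - X 1) * h3 + X 0 * h4
  · linear_combination -(X 0 - X 1) * h3 + X 1 * h4

theorem eigenSubst_eigenSubstInv {a : K} (ha : a ≠ 0) (h2 : (2 : K) ≠ 0)
    (P : MvPolynomial (Fin 2) K) : eigenSubst a (eigenSubstInv a P) = P := by
  rw [← AlgHom.comp_apply]
  conv_rhs => rw [← AlgHom.id_apply (R := K) P]
  congr 1
  apply MvPolynomial.algHom_ext
  have h3 : C a * C (2 * a)⁻¹ = (C 2⁻¹ : MvPolynomial (Fin 2) K) := by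
    rw [← C_mul]
    congr 1
    field_simp
  have h4 : (C 2⁻¹ : MvPolynomial (Fin 2) K) + C 2⁻¹ = 1 := by
    rw [← C_add, ← two_mul, mul_inv_cancel₀ h2, C_1]
  rw [Fin.forall_fin_two]
  simp only [AlgHom.comp_apply, AlgHom.id_apply, eigenSubst, eigenSubstInv, aeval_X, map_add,
    map_sub, map_mul, aeval_C, algebraMap_eq, Matrix.cons_val_zero, Matrix.cons_val_one, C_neg]
  constructor
  · linear_combination 2 * X 0 * h3 + X 0 * h4
  · linear_combination X 1 * h4

/-- The exponent of `X^(m-j) Y^j`. -/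
noncomputable def binaryExponent (m j : ℕ) : Fin 2 →₀ ℕ :=
  Finsupp.single 0 (m - j) + Finsupp.single 1 j

theorem binaryExponent_injective (m : ℕ) : Function.Injective (binaryExponent m) := by
  intro i j h
  simpa [binaryExponent] using DFunLike.congr_fun h 1

theorem eq_sum_monomial_of_isHomogeneous {m : ℕ} {P : MvPolynomial (Fin 2) K}
    (hP : P.IsHomogeneous m) :
    P = ∑ j ∈ Finset.range (m + 1),
      monomial (binaryExponent m j) (P.coeff (binaryExponent m j)) := by
  classical
  ext d
  rw [coeff_sum]
  simp only [coeff_monomial]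
  by_cases hd : P.coeff d = 0
  · rw [hd, Finset.sum_eq_zero]
    intro j _
    split_ifs with h
    · rw [h, hd]
    · rfl
  · have hdeg := hP hd
    rw [Finsupp.weight_apply, Finsupp.sum_fintype _ _ (by simp), Fin.sum_univ_two] at hdeg
    simp only [Pi.one_apply, smul_eq_mul, mul_one] at hdeg
    have hbd : binaryExponent m (d 1) = d := by
      ext i
      fin_cases i
      · simp [binaryExponent]
        omega
      · simp [binaryExponent]
    rw [Finset.sum_eq_single (d 1), hbd, if_pos rfl]
    · intro j _ hj
      rw [if_neg]
      intro h
      exact hj (binaryExponent_injective m (h.trans hbd.symm))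
    · intro h
      rw [Finset.mem_range] at h
      omega

/-- `V_m ⊗ 𝔽_{p²}` has a basis of eigenvectors for the anisotropic torus. -/
theorem exists_torus_eigenbasis [Algebra (ZMod p) K] [Fintype K] {α : K} {β : ZMod p}
    (hq : QuadraticGenerator p α β) (m : ℕ) :
    ∃ (e : ℕ → MvPolynomial (Fin 2) K) (c : ℕ → MvPolynomial (Fin 2) K →ₗ[K] K),
      (∀ j < m + 1, e j ∈ homogeneousSubmodule (Fin 2) K m) ∧
      (∀ t ∈ anisotropicTorus p β, ∀ j,
        actK2 p K t.val (e j) = rowCoord α t 0 ^ (m - j + p * j) • e j) ∧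
      (∀ i j, c i (e j) = if i = j then 1 else 0) ∧
      ∀ P ∈ homogeneousSubmodule (Fin 2) K m, P = ∑ j ∈ Finset.range (m + 1), c j P • e j := by
  classical
  have hlin (a : K) : (X 1 + C a * X 0 : MvPolynomial (Fin 2) K).IsHomogeneous 1 :=
    (isHomogeneous_X K 1).add (by simpa using (isHomogeneous_X K 0).C_mul a)
  refine ⟨fun j => eigenSubst α (monomial (binaryExponent m j) 1),
    fun j => lcoeff K (binaryExponent m j) ∘ₗ (eigenSubstInv α).toLinearMap,
    fun j hj => ?_, fun t ht j => ?_, fun i j => ?_, fun P hP => ?_⟩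
  · rw [mem_homogeneousSubmodule, ← one_mul m]
    refine IsHomogeneous.aeval (isHomogeneous_monomial 1 ?_) _ (Fin.forall_fin_two.mpr ?_)
    · rw [Finsupp.degree_eq_sum, Fin.sum_univ_two]
      simp [binaryExponent]
      omega
    · exact ⟨hlin α, hlin (-α)⟩
  · have hη : actK2 p K t.val (X 1 + C (-α) * X 0) =
        C (rowCoord α t 0 ^ p) * (X 1 + C (-α) * X 0) := by
      rw [actK2_torus_X_add ht (by rw [neg_sq, hq.sq]), rowCoord_neg hq]
    have hξ := actK2_torus_X_add ht hq.sq
    have he : eigenSubst α (monomial (binaryExponent m j) 1) =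
        (X 1 + C α * X 0) ^ (m - j) * (X 1 + C (-α) * X 0) ^ j := by
      rw [binaryExponent, ← one_mul (1 : K), ← monomial_mul, ← X_pow_eq_monomial,
        ← X_pow_eq_monomial, map_mul, map_pow, map_pow]
      simp [eigenSubst]
    beta_reduce
    rw [he]
    simp only [actK2, AlgHom.toLinearMap_apply] at hξ hη ⊢
    rw [map_mul, map_pow, map_pow, hξ, hη, smul_eq_C_mul, mul_pow, mul_pow]
    simp only [C_pow]
    ring
  · simp only [LinearMap.comp_apply, AlgHom.toLinearMap_apply,
      eigenSubstInv_eigenSubst hq.ne_zero hq.two_ne_zero, lcoeff_apply, coeff_monomial,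
      (binaryExponent_injective m).eq_iff, eq_comm]
  · have hP' : (eigenSubstInv α P).IsHomogeneous m := by
      rw [← one_mul m]
      refine IsHomogeneous.aeval hP _ (Fin.forall_fin_two.mpr ⟨?_, ?_⟩)
      · exact ((isHomogeneous_X K 0).sub (isHomogeneous_X K 1)).C_mul _
      · exact ((isHomogeneous_X K 0).add (isHomogeneous_X K 1)).C_mul _
    conv_lhs => rw [← eigenSubst_eigenSubstInv hq.ne_zero hq.two_ne_zero P,
      eq_sum_monomial_of_isHomogeneous hP', map_sum]
    refine Finset.sum_congr rfl fun j _ => ?_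
    rw [← map_smul, smul_monomial, smul_eq_mul, mul_one]
    rfl

end TorusEigenbasis

/-- for odd `p`, `m ≥ 0` and `2m−1 ≤ r ≤ p−3`, there is a `G`-equivariant
`𝔽_{p²}`-linear isomorphism
`((V_{r+2+(m+1)(p−1)} / D^{m+1}(V_{r+2})) ⊗ V_{p−1}) ⊗ 𝔽_{p²} ≅ ind_T^G (V_m ⊗ ω₂^{r+2−m})`,
expressed here by a linear map `ψ` inducing it. -/
theorem cuspidal_higher_D_iso (p : ℕ) [Fact p.Prime] (hodd : Odd p)
    (m : ℕ) (r : ℤ) (hr1 : 2 * (m : ℤ) - 1 ≤ r) (hr2 : r ≤ (p : ℤ) - 3)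
    (K : Type*) [Field K] [Algebra (ZMod p) K] [Fintype K]
    (hK : Fintype.card K = p ^ 2)
    (α : K) (β : ZMod p) (hα : α ^ 2 = algebraMap (ZMod p) K β)
    (hα' : α ∉ Set.range (algebraMap (ZMod p) K)) :
    ∃ ψ : MvPolynomial (Fin 2 × Fin 2) K →ₗ[K]
        (Matrix.GeneralLinearGroup (Fin 2) (ZMod p) → MvPolynomial (Fin 2) K),
      -- the values of `ψ_R` lie in `V_m ⊗ 𝔽_{p²}`
      (∀ R : MvPolynomial (Fin 2 × Fin 2) K,
          IsBiHom (r + 2 + ((m : ℤ) + 1) * ((p : ℤ) - 1)).toNat (p - 1) R →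
          ∀ g, ψ R g ∈ homogeneousSubmodule (Fin 2) K m) ∧
      -- `ψ_R` lies in `ind_T^G (V_m ⊗ ω₂^{r+2−m})`
      (∀ R : MvPolynomial (Fin 2 × Fin 2) K,
          IsBiHom (r + 2 + ((m : ℤ) + 1) * ((p : ℤ) - 1)).toNat (p - 1) R →
          ∀ (t g : Matrix.GeneralLinearGroup (Fin 2) (ZMod p)) (u v : ZMod p),
            t.val = !![u, v * β; v, u] →
            ψ R (t * g) =
              (algebraMap (ZMod p) K u + algebraMap (ZMod p) K v * α) ^
                  (r + 2 - (m : ℤ)).toNat • actK2 p K t.val (ψ R g)) ∧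
      -- `G`-equivariance
      (∀ (g : Matrix.GeneralLinearGroup (Fin 2) (ZMod p))
          (R : MvPolynomial (Fin 2 × Fin 2) K),
          IsBiHom (r + 2 + ((m : ℤ) + 1) * ((p : ℤ) - 1)).toNat (p - 1) R →
          ψ (actK p K g.val R) = fun x => ψ R (x * g)) ∧
      -- the kernel is `D^{m+1}(V_{r+2}) ⊗ V_{p−1}`
      (∀ R : MvPolynomial (Fin 2 × Fin 2) K,
          IsBiHom (r + 2 + ((m : ℤ) + 1) * ((p : ℤ) - 1)).toNat (p - 1) R →
          (ψ R = 0 ↔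
            ∃ S, IsBiHom (r + 2).toNat (p - 1) S ∧ (DK p K ^ (m + 1)) S = R)) ∧
      -- surjectivity onto `ind_T^G (V_m ⊗ ω₂^{r+2−m})`
      (∀ h : Matrix.GeneralLinearGroup (Fin 2) (ZMod p) → MvPolynomial (Fin 2) K,
          (∀ g, h g ∈ homogeneousSubmodule (Fin 2) K m) →
          (∀ (t g : Matrix.GeneralLinearGroup (Fin 2) (ZMod p)) (u v : ZMod p),
              t.val = !![u, v * β; v, u] →
              h (t * g) =
                (algebraMap (ZMod p) K u + algebraMap (ZMod p) K v * α) ^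
                    (r + 2 - (m : ℤ)).toNat • actK2 p K t.val (h g)) →
          ∃ R, IsBiHom (r + 2 + ((m : ℤ) + 1) * ((p : ℤ) - 1)).toNat (p - 1) R ∧
            ψ R = h) := by
  have hq : QuadraticGenerator p α β := ⟨hodd, hK, hα, hα'⟩
  have hp := (Fact.out : p.Prime).pos
  obtain ⟨ρ, hρ⟩ : ∃ ρ : ℕ, (ρ : ℤ) = r + 2 := ⟨(r + 2).toNat, by omega⟩
  have hn : (r + 2 + ((m : ℤ) + 1) * ((p : ℤ) - 1)).toNat = ρ + (m + 1) * (p - 1) := by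
    rw [← hρ, ← Int.toNat_natCast (ρ + (m + 1) * (p - 1))]
    push_cast [Nat.cast_sub (show 1 ≤ p from hp)]
    rfl
  have hρ' : (r + 2).toNat = ρ := by omega
  have hρm : (r + 2 - (m : ℤ)).toNat = ρ - m := by omega
  rw [hn, hρ', hρm]
  have hbi (n : ℕ) (R : MvPolynomial (Fin 2 × Fin 2) K) := isBiHom_iff (n := n) (R := R) hp
  simp only [hbi]
  obtain ⟨φ, hφ, hker, hsurj⟩ :=
    exists_functionals_of_iterated_quotient hq (m := m) (ρ := ρ) (by omega) (by omega) le_rfl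
  obtain ⟨e, c, hem, het, hce, hsum⟩ := exists_torus_eigenbasis hq m
  have hexp (t : GL (Fin 2) (ZMod p)) {j : ℕ} (hj : j < m + 1) :
      rowCoord α t 0 ^ (ρ - m) * rowCoord α t 0 ^ (m - j + p * j) =
        rowCoord α t 0 ^ (ρ + j * (p - 1)) := by
    rw [← pow_add]
    congr 1
    obtain ⟨n, rfl⟩ : ∃ n, p = n + 1 := ⟨p - 1, by omega⟩
    rw [Nat.add_sub_cancel, add_one_mul, mul_comm j n]
    omega
  have hc {j : ℕ} (hj : j < m + 1) (f : ℕ → K) :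
      c j (∑ l ∈ Finset.range (m + 1), f l • e l) = f j := by
    simp only [map_sum, map_smul, hce, smul_eq_mul, mul_ite, mul_one, mul_zero,
      Finset.sum_ite_eq, Finset.mem_range, if_pos hj]
  have hact {t : GL (Fin 2) (ZMod p)} (ht : t ∈ anisotropicTorus p β) (f : ℕ → K) :
      rowCoord α t 0 ^ (ρ - m) • actK2 p K t.val (∑ l ∈ Finset.range (m + 1), f l • e l) =
        ∑ l ∈ Finset.range (m + 1), (rowCoord α t 0 ^ (ρ + l * (p - 1)) * f l) • e l := by
    rw [map_sum, Finset.smul_sum]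
    refine Finset.sum_congr rfl fun l hl => ?_
    rw [map_smul, het t ht, smul_smul, smul_smul, ← hexp t (Finset.mem_range.mp hl)]
    congr 1
    ring
  have hrow {t : GL (Fin 2) (ZMod p)} {u v : ZMod p} (h : t.val = !![u, v * β; v, u]) :
      algebraMap (ZMod p) K u + algebraMap (ZMod p) K v * α = rowCoord α t 0 := by
    simp [rowCoord, h]
  refine ⟨LinearMap.pi fun g => ∑ j ∈ Finset.range (m + 1),
    (φ j ∘ₗ actK p K g.val).smulRight (e j), ?_⟩
  set ψ : MvPolynomial (Fin 2 × Fin 2) K →ₗ[K]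
      (GL (Fin 2) (ZMod p) → MvPolynomial (Fin 2) K) :=
    LinearMap.pi fun g => ∑ j ∈ Finset.range (m + 1),
      (φ j ∘ₗ actK p K g.val).smulRight (e j) with hψ
  have hψa (R) (g : GL (Fin 2) (ZMod p)) :
      ψ R g = ∑ j ∈ Finset.range (m + 1), orbitMap p (φ j) R g • e j := by
    simp [hψ, orbitMap_apply]
  refine ⟨fun R _ g => ?_, fun R _ t g u v ht => ?_, fun g R _ => ?_, fun R hR => ?_,
    fun h hm hind => ?_⟩
  · rw [hψa]
    exact Submodule.sum_mem _ fun j hj => Submodule.smul_mem _ _ (hem j (Finset.mem_range.mp hj))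
  · have htm := mem_anisotropicTorus_of_eq ht
    rw [hrow ht, hψa, hψa, hact htm]
    refine Finset.sum_congr rfl fun j hj => ?_
    rw [orbitMap_mem (hφ j (Finset.mem_range.mp hj)) (fun _ => Submodule.mem_top) t htm]
  · funext x
    simp only [hψa, orbitMap_apply, Units.val_mul, actK_mul_apply]
  · rw [← hker R hR]
    constructor
    · intro h0 j hj
      funext g
      have := congr_arg (c j) (congr_fun h0 g)
      rwa [hψa, hc hj, Pi.zero_apply, map_zero] at this
    · intro h0
      funext g
      rw [hψa]
      refine Finset.sum_eq_zero fun j hj => ?_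
      rw [h0 j (Finset.mem_range.mp hj), Pi.zero_apply, zero_smul]
  · obtain ⟨R, hR, hRh⟩ := hsurj (fun j g => c j (h g)) fun j hj t ht g => by
      beta_reduce
      rw [hind t g _ _ (mem_anisotropicTorus.mp ht), hrow (mem_anisotropicTorus.mp ht)]
      conv_lhs => rw [hsum _ (hm g), hact ht, hc hj]
    refine ⟨R, hR, ?_⟩
    funext g
    rw [hψa, hsum _ (hm g)]
    refine Finset.sum_congr rfl fun j hj => ?_
    rw [hRh j (Finset.mem_range.mp hj)]
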